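/- arXiv:1208.6267 — 3 statements merged into one kernel-verified Lean document; each statement's English description precedes it below -/
import Mathlib

section
/- Let R be a noetherian K-algebra domain equipped with a rational action of a K-torus H of rank r by K-algebra automorphisms (encoded by a ℤʳ-grading of R as below), and assume R is an H-UFD. Then the normal subalgebra N(R) of R, i.e., the subalgebra generated by all normal elements of R, is precisely the subalgebra of R generated by the homogeneous prime elements of R together with the units of R. -/
/-- `u` is a normal element of `R`: `uR = Ru`. -/
def IsNormalElem {R : Type*} [Ring R] (u : R) : Prop :=
  {y : R | ∃ t : R, y = u * t} = {y : R | ∃ t : R, y = t * u}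

/-- For a normal element `u`, `u ∣ a` means `a ∈ Ru`. -/
def NDvd {R : Type*} [Ring R] (u a : R) : Prop := ∃ t : R, a = t * u

/-- A prime element of a domain `R`: a nonzero normal element `p` such that `Rp`
is a completely prime ideal of `R`; in particular `p` is not a unit
(`1 ∉ Rp`). -/
def IsPrimeElem {R : Type*} [Ring R] (p : R) : Prop :=
  p ≠ 0 ∧ IsNormalElem p ∧ ¬ NDvd p 1 ∧
    ∀ a b : R, NDvd p (a * b) → NDvd p a ∨ NDvd p b

/-- `S` is a two-sided ideal of `R`, as a set. -/
def IsIdealSet {R : Type*} [Ring R] (S : Set R) : Prop :=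
  (0 : R) ∈ S ∧ (∀ a ∈ S, ∀ b ∈ S, a + b ∈ S) ∧
    ∀ r : R, ∀ a ∈ S, r * a ∈ S ∧ a * r ∈ S

/-- `S` is a prime two-sided ideal of `R` (elementwise characterization:
`aRb ⊆ S` implies `a ∈ S` or `b ∈ S`, and `S` is proper). -/
def IsPrimeIdealSet {R : Type*} [Ring R] (S : Set R) : Prop :=
  IsIdealSet S ∧ (1 : R) ∉ S ∧
    ∀ a b : R, (∀ t : R, a * t * b ∈ S) → a ∈ S ∨ b ∈ S

/-- Noncommutative unique factorization domain condition: every nonzero prime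
ideal contains a prime element. -/
def IsNCUFD (R : Type*) [Ring R] : Prop :=
  ∀ S : Set R, IsPrimeIdealSet S → S ≠ {0} → ∃ p ∈ S, IsPrimeElem p

section GradedDefs

variable {K : Type*} [Field K] {R : Type*} [Ring R] [Algebra K R] {r : ℕ}

/-- `tᵐ = t₁^{m₁} ⋯ t_r^{m_r}` for a torus element `t ∈ (Kˣ)ʳ` and a character
`m ∈ ℤʳ`. -/
def tpow (t : Fin r → Kˣ) (m : Fin r → ℤ) : Kˣ := ∏ i, t i ^ m i

/-- A homogeneous (`H`-stable) two-sided ideal for the `ℤʳ`-grading `𝒜`. -/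
def IsHomogIdealSet (𝒜 : (Fin r → ℤ) → Submodule K R) [GradedAlgebra 𝒜]
    (S : Set R) : Prop :=
  IsIdealSet S ∧ ∀ a ∈ S, ∀ m : Fin r → ℤ, ((DirectSum.decompose 𝒜 a m : R) ∈ S)

/-- An `H`-prime ideal for the torus action encoded by the grading `𝒜`:
a proper homogeneous ideal `P` with `I·J ⊆ P → I ⊆ P ∨ J ⊆ P` for all
homogeneous ideals `I`, `J`. -/
def IsHPrimeIdealSet (𝒜 : (Fin r → ℤ) → Submodule K R) [GradedAlgebra 𝒜]
    (S : Set R) : Prop :=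
  IsHomogIdealSet 𝒜 S ∧ (1 : R) ∉ S ∧
    ∀ I J : Set R, IsHomogIdealSet 𝒜 I → IsHomogIdealSet 𝒜 J →
      (∀ a ∈ I, ∀ b ∈ J, a * b ∈ S) → I ⊆ S ∨ J ⊆ S

/-- `R` is an `H`-UFD for the torus action encoded by the grading `𝒜`: every
nonzero `H`-prime ideal contains a homogeneous prime element. -/
def IsHUFDg (𝒜 : (Fin r → ℤ) → Submodule K R) [GradedAlgebra 𝒜] : Prop :=
  ∀ S : Set R, IsHPrimeIdealSet 𝒜 S → S ≠ {0} →
    ∃ p ∈ S, IsPrimeElem p ∧ ∃ m : Fin r → ℤ, p ∈ 𝒜 m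

/-- `u` is `H`-normal for the torus action encoded by the grading `𝒜`:
there is `t ∈ (Kˣ)ʳ` with `u·b = tᵐ·b·u` for every homogeneous `b` of any
degree `m`. -/
def IsHNormalg (𝒜 : (Fin r → ℤ) → Submodule K R) (u : R) : Prop :=
  ∃ t : Fin r → Kˣ, ∀ m : Fin r → ℤ, ∀ b ∈ 𝒜 m,
    u * b = ((tpow t m : Kˣ) : K) • (b * u)

/-- An `H`-prime element: a prime element which is homogeneous and `H`-normal. -/
def IsHPrimeElemg (𝒜 : (Fin r → ℤ) → Submodule K R) (p : R) : Prop :=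
  IsPrimeElem p ∧ (∃ m : Fin r → ℤ, p ∈ 𝒜 m) ∧ IsHNormalg 𝒜 p

/-- `R` is a strong `H`-UFD for the torus action encoded by the grading `𝒜`:
every nonzero `H`-prime ideal contains an `H`-prime element. -/
def IsStrongHUFDg (𝒜 : (Fin r → ℤ) → Submodule K R) [GradedAlgebra 𝒜] : Prop :=
  ∀ S : Set R, IsHPrimeIdealSet 𝒜 S → S ≠ {0} → ∃ p ∈ S, IsHPrimeElemg 𝒜 p

end GradedDefs

section NormalElements

variable {R : Type*} [Ring R]

theorem isNormalElem_iff {u : R} :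
    IsNormalElem u ↔ (∀ b, ∃ c, u * b = c * u) ∧ ∀ c, ∃ b, c * u = u * b := by
  refine ⟨fun h => ⟨fun b => ?_, fun c => ?_⟩, fun h => ?_⟩
  · have : u * b ∈ {y : R | ∃ t : R, y = t * u} := h ▸ ⟨b, rfl⟩
    exact this
  · have : c * u ∈ {y : R | ∃ t : R, y = u * t} := h.symm ▸ ⟨c, rfl⟩
    exact this
  · ext y
    constructor
    · rintro ⟨b, rfl⟩
      exact h.1 b
    · rintro ⟨c, rfl⟩
      exact h.2 c

theorem IsUnit.isNormalElem {u : R} (hu : IsUnit u) : IsNormalElem u := by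
  obtain ⟨v, rfl⟩ := hu
  exact isNormalElem_iff.2
    ⟨fun b => ⟨v * b * ↑v⁻¹, by simp⟩, fun c => ⟨↑v⁻¹ * c * v, by simp [mul_assoc]⟩⟩

variable [IsDomain R]

theorem IsNormalElem.of_mul_left {p u : R} (hp : IsNormalElem p) (hp0 : p ≠ 0)
    (hpu : IsNormalElem (p * u)) : IsNormalElem u := by
  rw [isNormalElem_iff] at hp hpu ⊢
  refine ⟨fun b => ?_, fun c => ?_⟩
  · obtain ⟨c, hc⟩ := hpu.1 b
    obtain ⟨d, hd⟩ := hp.2 c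
    refine ⟨d, mul_left_cancel₀ hp0 ?_⟩
    rw [← mul_assoc, hc, ← mul_assoc, hd, mul_assoc]
  · obtain ⟨d, hd⟩ := hp.1 c
    obtain ⟨b, hb⟩ := hpu.2 d
    refine ⟨b, mul_left_cancel₀ hp0 ?_⟩
    rw [← mul_assoc, hd, mul_assoc, hb, mul_assoc]

/-- A normal element dividing a product of prime elements is a product of some of these prime
elements and a unit. -/
theorem IsNormalElem.mem_closure_of_dvd {P : Set R} (hP : ∀ p ∈ P, IsPrimeElem p) {w : R}
    (hw : w ∈ Submonoid.closure P) :
    ∀ t u : R, IsNormalElem u → w = t * u → u ∈ Submonoid.closure (P ∪ {u | IsUnit u}) := by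
  induction hw using Submonoid.closure_induction_left with
  | one =>
    intro t u _ h
    have hu : u ≠ 0 := by
      rintro rfl
      simp at h
    have h' : u * t = 1 := mul_right_cancel₀ hu (by rw [mul_assoc, ← h, one_mul, mul_one])
    exact Submonoid.subset_closure (Or.inr ⟨⟨u, t, h', h.symm⟩, rfl⟩)
  | mul_left p hp w _ ih =>
    intro t u hu h
    obtain ⟨hp0, hpn, -, hpp⟩ := hP p hp
    obtain ⟨hpl, hpr⟩ := isNormalElem_iff.1 hpn
    obtain ⟨s, hs⟩ := hpl w
    rcases hpp t u ⟨s, h.symm.trans hs⟩ with ⟨a, rfl⟩ | ⟨a, rfl⟩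
    · obtain ⟨b, hb⟩ := hpr a
      refine ih b u hu (mul_left_cancel₀ hp0 ?_)
      rw [h, hb, mul_assoc]
    · obtain ⟨b, hb⟩ := hpr a
      rw [hb] at hu h ⊢
      obtain ⟨c, hc⟩ := hpr t
      refine mul_mem (Submonoid.subset_closure (Or.inl hp))
        (ih c b (hpn.of_mul_left hp0 hu) (mul_left_cancel₀ hp0 ?_))
      rw [h, ← mul_assoc, hc, mul_assoc]

end NormalElements

section HomogeneousComponents

variable {K : Type*} [Field K] {R : Type*} [Ring R] [Algebra K R]

theorem coe_decompose_mul_add_of_unique {ι : Type*} [AddCancelMonoid ι] [DecidableEq ι]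
    (𝒜 : ι → Submodule K R) [GradedAlgebra 𝒜] {f g : R} {a c : ι}
    (h : ∀ i j, (DirectSum.decompose 𝒜 f i : R) ≠ 0 → (DirectSum.decompose 𝒜 g j : R) ≠ 0 →
      i + j = a + c → i = a ∧ j = c) :
    (DirectSum.decompose 𝒜 (f * g) (a + c) : R) =
      DirectSum.decompose 𝒜 f a * DirectSum.decompose 𝒜 g c := by
  classical
  rw [DirectSum.decompose_mul, DirectSum.coe_mul_apply]
  refine Finset.sum_eq_single (a, c) ?_ ?_
  · rintro ⟨i, j⟩ hij hne
    simp only [Finset.mem_filter, Finset.mem_product, DFinsupp.mem_support_iff] at hij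
    obtain ⟨rfl, rfl⟩ := h i j (by simpa using hij.1.1) (by simpa using hij.1.2) hij.2
    exact absurd rfl hne
  · intro hac
    by_contra hne
    refine hac ?_
    simp only [Finset.mem_filter, Finset.mem_product, DFinsupp.mem_support_iff, and_true]
    refine ⟨fun h0 => hne ?_, fun h0 => hne ?_⟩ <;> simp [h0]

/-- If `u * b = c * u` with `b` homogeneous of degree `d`, then no homogeneous component of `c`
lies above `d`, in any ordering of the group of degrees. -/
theorem degree_le_of_mul_eq_mul [IsDomain R] {ι Γ : Type*} [AddCommGroup ι] [DecidableEq ι]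
    [AddCommGroup Γ] [LinearOrder Γ] [IsOrderedAddMonoid Γ] {e : ι →+ Γ}
    (he : Function.Injective e) (𝒜 : ι → Submodule K R) [GradedAlgebra 𝒜] {u b c : R} {d : ι}
    (hu : u ≠ 0) (hb : b ∈ 𝒜 d) (h : u * b = c * u) (i : ι)
    (hi : (DirectSum.decompose 𝒜 c i : R) ≠ 0) : e i ≤ e d := by
  classical
  obtain ⟨a, ha, hmaxa⟩ := (DirectSum.decompose 𝒜 c).support.exists_max_image e
    ⟨i, by simpa using hi⟩
  have hne : (DirectSum.decompose 𝒜 u).support.Nonempty := by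
    rw [Finset.nonempty_iff_ne_empty, Ne, DFinsupp.support_eq_empty]
    exact fun h0 => hu ((DirectSum.decompose 𝒜).injective
      (h0.trans (DirectSum.decompose_zero 𝒜).symm))
  obtain ⟨k, hk, hmaxk⟩ := (DirectSum.decompose 𝒜 u).support.exists_max_image e hne
  simp only [DFinsupp.mem_support_iff, ← Submodule.coe_eq_zero.not] at ha hk hmaxa hmaxk
  refine (hmaxa i hi).trans ?_
  have hprod : (DirectSum.decompose 𝒜 (c * u) (a + k) : R) ≠ 0 := by
    rw [coe_decompose_mul_add_of_unique 𝒜]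
    · exact mul_ne_zero ha hk
    · intro x y hx hy hxy
      have hsum : e x + e y = e a + e k := by rw [← map_add, hxy, map_add]
      have := (add_eq_add_iff_eq_and_eq (hmaxa x hx) (hmaxk y hy)).1 hsum
      exact ⟨he this.1, he this.2⟩
  rw [← h, show a + k = (a + k - d) + d by abel,
    DirectSum.coe_decompose_mul_add_of_right_mem 𝒜 hb] at hprod
  have := hmaxk _ (left_ne_zero_of_mul hprod)
  rw [map_sub, map_add] at this
  rw [← sub_nonneg] at this ⊢
  convert this using 1
  abel

variable [IsDomain R] {r : ℕ} (𝒜 : (Fin r → ℤ) → Submodule K R) [GradedAlgebra 𝒜]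

theorem mem_of_mul_eq_mul {u b c : R} {d : Fin r → ℤ} (hu : u ≠ 0) (hb : b ∈ 𝒜 d)
    (h : u * b = c * u) : c ∈ 𝒜 d := by
  classical
  let e : (Fin r → ℤ) →+ Lex (Fin r → ℤ) := ⟨⟨toLex, rfl⟩, fun _ _ => rfl⟩
  have he : Function.Injective e := toLex.injective
  have key : ∀ i, (DirectSum.decompose 𝒜 c i : R) ≠ 0 → i = d := fun i hi =>
    he (le_antisymm (degree_le_of_mul_eq_mul he 𝒜 hu hb h i hi)
      (neg_le_neg_iff.1 (degree_le_of_mul_eq_mul (e := -e) (neg_injective.comp he)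
        𝒜 hu hb h i hi)))
  rw [← DirectSum.sum_support_decompose 𝒜 c]
  refine Submodule.sum_mem _ fun i hi => ?_
  rw [← key i (by simpa using hi)]
  exact SetLike.coe_mem _

theorem IsNormalElem.decompose_mul_eq {u : R} (hu0 : u ≠ 0) (hu : IsNormalElem u) {b c : R}
    (h : u * b = c * u) (m : Fin r → ℤ) :
    (DirectSum.decompose 𝒜 u m : R) * b = c * DirectSum.decompose 𝒜 u m := by
  obtain ⟨c', hcu, hm⟩ : ∃ c', u * b = c' * u ∧
      (DirectSum.decompose 𝒜 u m : R) * b = c' * DirectSum.decompose 𝒜 u m := by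
    clear h c
    induction b using DirectSum.Decomposition.inductionOn 𝒜 with
    | zero => exact ⟨0, by simp, by simp⟩
    | @homogeneous d b =>
      obtain ⟨c, hc⟩ := (isNormalElem_iff.1 hu).1 b
      have hcd := mem_of_mul_eq_mul 𝒜 hu0 b.2 hc
      refine ⟨c, hc, ?_⟩
      rw [← DirectSum.coe_decompose_mul_add_of_right_mem 𝒜 b.2, hc, add_comm,
        DirectSum.coe_decompose_mul_add_of_left_mem 𝒜 hcd]
    | add b₁ b₂ h₁ h₂ =>
      obtain ⟨c₁, h₁, h₁'⟩ := h₁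
      obtain ⟨c₂, h₂, h₂'⟩ := h₂
      exact ⟨c₁ + c₂, by rw [mul_add, add_mul, h₁, h₂], by rw [mul_add, add_mul, h₁', h₂']⟩
  rwa [mul_right_cancel₀ hu0 (h.symm.trans hcu)]

/-- The homogeneous components of a normal element are normal. -/
theorem IsNormalElem.decompose {u : R} (hu : IsNormalElem u) (m : Fin r → ℤ) :
    IsNormalElem (DirectSum.decompose 𝒜 u m : R) := by
  rcases eq_or_ne u 0 with rfl | hu0
  · simpa using hu
  · refine isNormalElem_iff.2 ⟨fun b => ?_, fun c => ?_⟩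
    · obtain ⟨c, hc⟩ := (isNormalElem_iff.1 hu).1 b
      exact ⟨c, hu.decompose_mul_eq 𝒜 hu0 hc m⟩
    · obtain ⟨b, hb⟩ := (isNormalElem_iff.1 hu).2 c
      exact ⟨b, (hu.decompose_mul_eq 𝒜 hu0 hb.symm m).symm⟩

end HomogeneousComponents

section HomogeneousIdeals

variable {K : Type*} [Field K] {R : Type*} [Ring R] [Algebra K R] {r : ℕ}
  (𝒜 : (Fin r → ℤ) → Submodule K R) [GradedAlgebra 𝒜]

/-- A two-sided ideal given as a set, as a left ideal. -/
def IsIdealSet.toIdeal {S : Set R} (hS : IsIdealSet S) : Ideal R where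
  carrier := S
  zero_mem' := hS.1
  add_mem' {a b} ha hb := hS.2.1 a ha b hb
  smul_mem' c a ha := (hS.2.2 c a ha).1

theorem IsHomogIdealSet.sup {I J : Ideal R} (hI : IsHomogIdealSet 𝒜 (I : Set R))
    (hJ : IsHomogIdealSet 𝒜 (J : Set R)) : IsHomogIdealSet 𝒜 ((I ⊔ J : Ideal R) : Set R) := by
  refine ⟨⟨zero_mem _, fun a ha b hb => add_mem ha hb, fun x a ha =>
    ⟨Ideal.mul_mem_left _ x ha, ?_⟩⟩, fun a ha m => ?_⟩ <;>
  obtain ⟨y, hy, z, hz, rfl⟩ := Submodule.mem_sup.1 ha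
  · rw [add_mul]
    exact add_mem (Ideal.mem_sup_left (hI.1.2.2 x y hy).2)
      (Ideal.mem_sup_right (hJ.1.2.2 x z hz).2)
  · rw [DirectSum.decompose_add, DirectSum.add_apply, Submodule.coe_add]
    exact add_mem (Ideal.mem_sup_left (hI.2 y hy m)) (Ideal.mem_sup_right (hJ.2 z hz m))

theorem IsNormalElem.isHomogIdealSet_span {u : R} {d : Fin r → ℤ} (hu : IsNormalElem u)
    (hd : u ∈ 𝒜 d) : IsHomogIdealSet 𝒜 (Ideal.span {u} : Set R) := by
  refine ⟨⟨zero_mem _, fun a ha b hb => add_mem ha hb, fun x a ha =>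
    ⟨Ideal.mul_mem_left _ x ha, ?_⟩⟩, fun a ha m => ?_⟩ <;>
  obtain ⟨t, rfl⟩ := Ideal.mem_span_singleton'.1 ha <;>
  refine Ideal.mem_span_singleton'.2 ?_
  · obtain ⟨c, hc⟩ := (isNormalElem_iff.1 hu).1 x
    exact ⟨t * c, by rw [mul_assoc, mul_assoc, hc]⟩
  · refine ⟨DirectSum.decompose 𝒜 t (m - d), ?_⟩
    rw [← DirectSum.coe_decompose_mul_add_of_right_mem 𝒜 hd, sub_add_cancel]

/-- In a noetherian `H`-UFD, every nonzero homogeneous ideal contains a product of homogeneous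
prime elements. -/
theorem IsHUFDg.exists_mem_closure [IsNoetherianRing R] (hR : IsHUFDg 𝒜) (I : Ideal R)
    (hI : IsHomogIdealSet 𝒜 (I : Set R)) (hI0 : I ≠ ⊥) :
    ∃ w ∈ I, w ∈ Submonoid.closure {u : R | IsPrimeElem u ∧ ∃ m : Fin r → ℤ, u ∈ 𝒜 m} := by
  induction I using WellFoundedGT.induction with
  | ind I ih =>
    by_cases hprime : IsHPrimeIdealSet 𝒜 (I : Set R)
    · obtain ⟨p, hpI, hp⟩ := hR I hprime fun h => hI0 (SetLike.coe_injective (by simpa using h))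
      exact ⟨p, hpI, Submonoid.subset_closure hp⟩
    · by_cases h1 : (1 : R) ∈ I
      · exact ⟨1, h1, one_mem _⟩
      · simp only [IsHPrimeIdealSet, not_and, not_forall, not_or] at hprime
        obtain ⟨S, T, hS, hT, hST, hSI, hTI⟩ := hprime hI h1
        have larger : ∀ {J : Set R} (hJ : IsHomogIdealSet 𝒜 J), ¬ J ⊆ I →
            ∃ w ∈ I ⊔ hJ.1.toIdeal,
              w ∈ Submonoid.closure {u : R | IsPrimeElem u ∧ ∃ m : Fin r → ℤ, u ∈ 𝒜 m} := by
          intro J hJ hJI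
          have hlt : I < I ⊔ hJ.1.toIdeal := left_lt_sup.2 hJI
          exact ih _ hlt (IsHomogIdealSet.sup 𝒜 hI hJ) (bot_le.trans_lt hlt).ne'
        obtain ⟨v, hv, hv'⟩ := larger hS hSI
        obtain ⟨w, hw, hw'⟩ := larger hT hTI
        refine ⟨v * w, ?_, mul_mem hv' hw'⟩
        obtain ⟨a, ha, s, hs, rfl⟩ := Submodule.mem_sup.1 hv
        obtain ⟨b, hb, t, ht, rfl⟩ := Submodule.mem_sup.1 hw
        rw [add_mul, mul_add s]
        exact add_mem (hI.1.2.2 _ a ha).2 (add_mem (hI.1.2.2 s b hb).1 (hST s hs t ht))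

end HomogeneousIdeals

/-- **Proposition 2.6** of Goodearl–Yakimov: in a noetherian `H`-UFD, the
normal subalgebra `N(R)` (generated by all normal elements) is generated by
the homogeneous prime elements together with the units of `R`. -/
theorem stmt8 {K : Type*} [Field K] {R : Type*} [Ring R] [Algebra K R]
    [IsDomain R] [IsNoetherianRing R] [IsNoetherianRing Rᵐᵒᵖ]
    {r : ℕ} (𝒜 : (Fin r → ℤ) → Submodule K R) [GradedAlgebra 𝒜]
    (hR : IsHUFDg 𝒜) :
    Algebra.adjoin K {u : R | IsNormalElem u} =
      Algebra.adjoin K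
        ({u : R | IsPrimeElem u ∧ ∃ m : Fin r → ℤ, u ∈ 𝒜 m} ∪
          {u : R | IsUnit u}) := by
  refine le_antisymm (Algebra.adjoin_le fun u hu => ?_) (Algebra.adjoin_mono ?_)
  · classical
    rw [← DirectSum.sum_support_decompose 𝒜 u]
    refine sum_mem fun m hm => ?_
    have hnorm := IsNormalElem.decompose 𝒜 hu m
    obtain ⟨w, hw, hwP⟩ := hR.exists_mem_closure 𝒜 _
      (hnorm.isHomogIdealSet_span 𝒜 (SetLike.coe_mem _)) (by simpa using hm)
    obtain ⟨t, ht⟩ := Ideal.mem_span_singleton'.1 hw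
    exact (Submonoid.closure_le (S := (Algebra.adjoin K _).toSubmonoid)).2 Algebra.subset_adjoin
      (hnorm.mem_closure_of_dvd (fun p hp => hp.1) hwP t _ ht.symm)
  · rintro u (⟨hu, -⟩ | hu)
    · exact hu.2.1
    · exact hu.isNormalElem
end

section
/- Let B be a K-algebra domain with a rational action of a K-torus H = (Kˣ)ʳ encoded by a ℤʳ-grading, assume B is an H-UFD, and let R = B[x;σ,δ] be a skew polynomial extension satisfying conditions (Cx1)–(Cx5). Let u be a homogeneous prime element of B and α ∈ Kˣ with σ(u) = α·u. Then exactly one of the following two situations occurs. (i) u remains a prime element of R; in this case u·x = α⁻¹·x·u and δ(u) = 0. (ii) There exists a unique element d∘ ∈ B such that v := u·x − d∘ is a homogeneous prime element of R; in this case, in the Ore localization B[u⁻¹] (to which σ and δ extend canonically), δ(b) = (u⁻¹d∘)·b − σ(b)·(u⁻¹d∘) for all b ∈ B; moreover v·x = α⁻¹·x·v, v·b = φ_u(σ(b))·v for all b ∈ B (where φ_u is the automorphism of B with u·b = φ_u(b)·u), u·d∘ = (αλ∘)⁻¹·d∘·u, δ(u) = α(λ∘ − 1)·d∘ ≠ 0,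 δ(d∘) = 0, and δ(u⁻¹d∘) = −(λ∘ − 1)·(u⁻¹d∘)² in B[u⁻¹]. -/
section SkewExt

variable {K : Type*} [Field K]
variable {B : Type*} [Ring B] [Algebra K B]
variable {R : Type*} [Ring R] [Algebra K R]
variable {r : ℕ}

/-- Normal elements `u`, `v` are associates: `u = a·v` for a unit `a`. -/
def AreAssoc {R : Type*} [Ring R] (u v : R) : Prop :=
  ∃ a : Rˣ, u = (a : R) * v

end SkewExt

/-- `R = B[x;σ,δ]`: the ring `R` is free as a left `B`-module on the powers of `x`, with
`x·b = σ(b)·x + δ(b)` for a `σ`-derivation `δ`. -/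
structure IsOreExt {K B R : Type*} [Field K] [Ring B] [Algebra K B] [Ring R] [Algebra K R]
    (ι : B →ₐ[K] R) (x : R) (σ : B ≃ₐ[K] B) (δ : B →ₗ[K] B) : Prop where
  free : ∀ a : R, ∃! c : ℕ →₀ B, a = c.sum fun n b => ι b * x ^ n
  comm : ∀ b : B, x * ι b = ι (σ b) * x + ι (δ b)
  der : ∀ a b : B, δ (a * b) = σ a * δ b + δ a * b

namespace IsOreExt

section Basic

variable {K B R : Type*} [Field K] [Ring B] [Algebra K B] [Ring R] [Algebra K R]
  {ι : B →ₐ[K] R} {x : R} {σ : B ≃ₐ[K] B} {δ : B →ₗ[K] B}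

/-- The polynomial `∑ ι (c n) * x ^ n`. -/
noncomputable def ofCoeff (ι : B →ₐ[K] R) (x : R) : (ℕ →₀ B) →ₗ[K] R :=
  Finsupp.lsum K fun n => (LinearMap.mulRight K (x ^ n)) ∘ₗ ι.toLinearMap

theorem ofCoeff_apply (c : ℕ →₀ B) :
    ofCoeff ι x c = c.sum fun n b => ι b * x ^ n := rfl

theorem ofCoeff_single (n : ℕ) (b : B) :
    ofCoeff ι x (Finsupp.single n b) = ι b * x ^ n := by
  simp [ofCoeff]

theorem bijective_ofCoeff (h : IsOreExt ι x σ δ) : Function.Bijective (ofCoeff ι x) := by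
  refine ⟨fun c d hcd => ?_, fun a => ?_⟩
  · obtain ⟨_, _, h2⟩ := h.free (ofCoeff ι x c)
    exact (h2 c (ofCoeff_apply c)).trans (h2 d (hcd.trans (ofCoeff_apply d))).symm
  · obtain ⟨c, h1, _⟩ := h.free a
    exact ⟨c, (ofCoeff_apply c).trans h1.symm⟩

/-- The left coefficient of `x ^ n`. -/
noncomputable def coeff (h : IsOreExt ι x σ δ) (n : ℕ) : R →ₗ[K] B :=
  Finsupp.lapply n ∘ₗ (LinearEquiv.ofBijective (ofCoeff ι x) h.bijective_ofCoeff).symm.toLinearMap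

theorem coeff_ofCoeff (h : IsOreExt ι x σ δ) (n : ℕ) (c : ℕ →₀ B) :
    h.coeff n (ofCoeff ι x c) = c n := by
  have : (LinearEquiv.ofBijective (ofCoeff ι x) h.bijective_ofCoeff).symm (ofCoeff ι x c) = c :=
    (LinearEquiv.ofBijective (ofCoeff ι x) h.bijective_ofCoeff).symm_apply_apply c
  simp [coeff, this]

theorem coeff_monomial (h : IsOreExt ι x σ δ) (n k : ℕ) (b : B) :
    h.coeff n (ι b * x ^ k) = if k = n then b else 0 := by
  rw [← ofCoeff_single, coeff_ofCoeff, Finsupp.single_apply]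

theorem ext_coeff (h : IsOreExt ι x σ δ) {f g : R} (H : ∀ n, h.coeff n f = h.coeff n g) :
    f = g := by
  obtain ⟨c, rfl⟩ := h.bijective_ofCoeff.2 f
  obtain ⟨d, rfl⟩ := h.bijective_ofCoeff.2 g
  congr 1
  ext n
  simpa [coeff_ofCoeff] using H n

theorem induct (h : IsOreExt ι x σ δ) {p : R → Prop} (f : R) (h0 : p 0)
    (hadd : ∀ f g, p f → p g → p (f + g)) (hmono : ∀ b n, p (ι b * x ^ n)) : p f := by
  obtain ⟨c, rfl⟩ := h.bijective_ofCoeff.2 f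
  induction c using Finsupp.induction_linear with
  | zero => simpa using h0
  | add c d hc hd => rw [map_add]; exact hadd _ _ hc hd
  | single n b => rw [ofCoeff_single]; exact hmono b n

theorem exists_degree_le (h : IsOreExt ι x σ δ) (f : R) : ∃ s, ∀ j, s < j → h.coeff j f = 0 := by
  obtain ⟨c, rfl⟩ := h.bijective_ofCoeff.2 f
  refine ⟨c.support.sup id, fun j hj => ?_⟩
  rw [coeff_ofCoeff]
  by_contra hne
  exact absurd (Finset.le_sup (f := id) (Finsupp.mem_support_iff.2 hne)) (by simpa using hj)

theorem coeff_ι (h : IsOreExt ι x σ δ) (n : ℕ) (b : B) :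
    h.coeff n (ι b) = if n = 0 then b else 0 := by
  simpa [eq_comm] using h.coeff_monomial n 0 b

theorem coeff_ι_zero (h : IsOreExt ι x σ δ) (b : B) : h.coeff 0 (ι b) = b := by
  simp [coeff_ι]

theorem coeff_ι_succ (h : IsOreExt ι x σ δ) (n : ℕ) (b : B) : h.coeff (n + 1) (ι b) = 0 := by
  simp [coeff_ι]

theorem ι_injective (h : IsOreExt ι x σ δ) : Function.Injective ι := fun a b hab => by
  rw [← h.coeff_ι_zero a, hab, h.coeff_ι_zero]

theorem coeff_ι_mul (h : IsOreExt ι x σ δ) (n : ℕ) (b : B) (f : R) :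
    h.coeff n (ι b * f) = b * h.coeff n f := by
  induction f using h.induct with
  | h0 => simp
  | hadd f g hf hg => simp [mul_add, hf, hg]
  | hmono c k => rw [← mul_assoc, ← map_mul, coeff_monomial, coeff_monomial]; split_ifs <;> simp

theorem coeff_mul_x_zero (h : IsOreExt ι x σ δ) (f : R) : h.coeff 0 (f * x) = 0 := by
  induction f using h.induct with
  | h0 => simp
  | hadd f g hf hg => simp [add_mul, hf, hg]
  | hmono c k => rw [mul_assoc, ← pow_succ, coeff_monomial]; simp

theorem coeff_mul_x_succ (h : IsOreExt ι x σ δ) (n : ℕ) (f : R) :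
    h.coeff (n + 1) (f * x) = h.coeff n f := by
  induction f using h.induct with
  | h0 => simp
  | hadd f g hf hg => simp [add_mul, hf, hg]
  | hmono c k => rw [mul_assoc, ← pow_succ, coeff_monomial, coeff_monomial]; simp

theorem x_mul_monomial (h : IsOreExt ι x σ δ) (b : B) (k : ℕ) :
    x * (ι b * x ^ k) = ι (σ b) * x ^ k * x + ι (δ b) * x ^ k := by
  rw [← mul_assoc, h.comm, add_mul, mul_assoc, mul_assoc, ← pow_succ, ← pow_succ']

theorem coeff_x_mul_zero (h : IsOreExt ι x σ δ) (f : R) :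
    h.coeff 0 (x * f) = δ (h.coeff 0 f) := by
  induction f using h.induct with
  | h0 => simp
  | hadd f g hf hg => simp [mul_add, hf, hg]
  | hmono c k =>
    rw [h.x_mul_monomial, map_add, coeff_mul_x_zero, coeff_monomial, coeff_monomial]
    split_ifs <;> simp

theorem coeff_x_mul_succ (h : IsOreExt ι x σ δ) (n : ℕ) (f : R) :
    h.coeff (n + 1) (x * f) = σ (h.coeff n f) + δ (h.coeff (n + 1) f) := by
  induction f using h.induct with
  | h0 => simp
  | hadd f g hf hg => simp only [mul_add, map_add, hf, hg]; abel
  | hmono c k =>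
    rw [h.x_mul_monomial, map_add, coeff_mul_x_succ]
    simp only [coeff_monomial]
    split_ifs <;> simp

theorem mul_x_cancel (h : IsOreExt ι x σ δ) {f g : R} (hfg : f * x = g * x) : f = g :=
  h.ext_coeff fun n => by rw [← h.coeff_mul_x_succ, hfg, h.coeff_mul_x_succ]

theorem exists_divX (h : IsOreExt ι x σ δ) (f : R) :
    ∃ g, f = ι (h.coeff 0 f) + g * x ∧ ∀ n, h.coeff n g = h.coeff (n + 1) f := by
  suffices H : ∃ b g, f = ι b + g * x by
    obtain ⟨b, g, rfl⟩ := H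
    refine ⟨g, ?_, fun n => ?_⟩
    · simp [coeff_ι_zero, coeff_mul_x_zero]
    · simp [coeff_ι_succ, coeff_mul_x_succ]
  induction f using h.induct with
  | h0 => exact ⟨0, 0, by simp⟩
  | hadd f g hf hg =>
    obtain ⟨b, f', rfl⟩ := hf
    obtain ⟨c, g', rfl⟩ := hg
    exact ⟨b + c, f' + g', by rw [map_add, add_mul]; abel⟩
  | hmono b n =>
    cases n with
    | zero => exact ⟨b, 0, by simp⟩
    | succ n => exact ⟨0, ι b * x ^ n, by simp [pow_succ, mul_assoc]⟩

/-- A polynomial of degree zero is a constant. -/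
theorem eq_ι_of_degree (h : IsOreExt ι x σ δ) {f : R} (hf : ∀ j, 0 < j → h.coeff j f = 0) :
    f = ι (h.coeff 0 f) := by
  refine h.ext_coeff fun n => ?_
  cases n with
  | zero => rw [coeff_ι_zero]
  | succ n => rw [coeff_ι_succ, hf _ n.succ_pos]

theorem coeff_mul_top (h : IsOreExt ι x σ δ) (s : ℕ) : ∀ (t : ℕ) (f g : R),
    (∀ j, s < j → h.coeff j f = 0) → (∀ j, t < j → h.coeff j g = 0) →
    (∀ j, s + t < j → h.coeff j (f * g) = 0) ∧
      h.coeff (s + t) (f * g) = h.coeff s f * (σ^[s]) (h.coeff t g) := by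
  induction s with
  | zero =>
    intro t f g hf hg
    rw [h.eq_ι_of_degree hf]
    simp only [coeff_ι_mul, coeff_ι_zero, zero_add]
    exact ⟨fun j hj => by rw [hg j hj, mul_zero], rfl⟩
  | succ s ih =>
    intro t f g hf hg
    obtain ⟨f', hff', hf'⟩ := h.exists_divX f
    have hfg : f * g = ι (h.coeff 0 f) * g + f' * (x * g) := by
      conv_lhs => rw [hff']
      rw [add_mul, mul_assoc]
    obtain ⟨h1, h2⟩ := ih (t + 1) f' (x * g) (fun j hj => by rw [hf', hf _ (by omega)])
      (fun j hj => by
        obtain ⟨j, rfl⟩ : ∃ i, j = i + 1 := ⟨j - 1, by omega⟩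
        rw [coeff_x_mul_succ, hg _ (by omega), hg _ (by omega), map_zero, map_zero, add_zero])
    refine ⟨fun j hj => ?_, ?_⟩
    · rw [hfg, map_add, coeff_ι_mul, hg j (by omega), h1 j (by omega), mul_zero, add_zero]
    · rw [hfg, map_add, coeff_ι_mul, hg _ (by omega), mul_zero, zero_add,
        show s + 1 + t = s + (t + 1) by omega, h2, hf', coeff_x_mul_succ, hg (t + 1) (by omega),
        map_zero, add_zero, Function.iterate_succ_apply]

theorem exists_top (h : IsOreExt ι x σ δ) {f : R} (hf : f ≠ 0) :
    ∃ s, h.coeff s f ≠ 0 ∧ ∀ j, s < j → h.coeff j f = 0 := by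
  classical
  have hex := h.exists_degree_le f
  refine ⟨Nat.find hex, fun h0 => ?_, Nat.find_spec hex⟩
  rcases Nat.eq_zero_or_pos (Nat.find hex) with hz | hp
  · have hs := Nat.find_spec hex
    rw [hz] at h0 hs
    exact hf (by rw [h.eq_ι_of_degree hs, h0, map_zero])
  · refine Nat.find_min hex (Nat.sub_lt hp one_pos) fun j hj => ?_
    rcases Nat.lt_or_ge (Nat.find hex) j with hlt | hge
    · exact Nat.find_spec hex j hlt
    · rwa [show j = Nat.find hex by omega]

/-- If `g` has degree `t` and `f * g` has degree less than `s + t`, then `f` has degree less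
than `s`. -/
theorem degree_of_mul [IsDomain B] (h : IsOreExt ι x σ δ) {f g : R} {s t : ℕ}
    (ht : h.coeff t g ≠ 0) (hg : ∀ j, t < j → h.coeff j g = 0)
    (hfg : ∀ j, s + t ≤ j → h.coeff j (f * g) = 0) : ∀ j, s ≤ j → h.coeff j f = 0 := by
  by_cases hf : f = 0
  · simp [hf]
  obtain ⟨n, hn, hn'⟩ := h.exists_top hf
  have hlt : n < s := by
    by_contra hge
    have h1 := (h.coeff_mul_top n t f g hn' hg).2
    rw [hfg _ (by omega), eq_comm, mul_eq_zero] at h1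
    rcases h1 with h1 | h1
    · exact hn h1
    · rw [← Function.iterate_fixed (map_zero σ) n] at h1
      exact ht (σ.injective.iterate n h1)
  exact fun j hj => hn' j (by omega)

theorem eq_zero_of_mul [IsDomain B] (h : IsOreExt ι x σ δ) {f g : R} {t : ℕ}
    (ht : h.coeff t g ≠ 0) (hg : ∀ j, t < j → h.coeff j g = 0)
    (hfg : ∀ j, t ≤ j → h.coeff j (f * g) = 0) : f = 0 :=
  h.ext_coeff fun n => by
    rw [h.degree_of_mul (s := 0) ht hg (by simpa using hfg) n n.zero_le, map_zero]

theorem eq_ι_of_mul [IsDomain B] (h : IsOreExt ι x σ δ) {f g : R} {t : ℕ}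
    (ht : h.coeff t g ≠ 0) (hg : ∀ j, t < j → h.coeff j g = 0)
    (hfg : ∀ j, t < j → h.coeff j (f * g) = 0) : f = ι (h.coeff 0 f) :=
  h.eq_ι_of_degree (h.degree_of_mul (s := 1) ht hg fun j hj => hfg j (by omega))

end Basic

end IsOreExt

namespace IsOreExt

section QComm

variable {K B R : Type*} [Field K] [Ring B] [Algebra K B] [Ring R] [Algebra K R]
  {ι : B →ₐ[K] R} {x : R} {σ : B ≃ₐ[K] B} {δ : B →ₗ[K] B}

theorem eq_sum_range (h : IsOreExt ι x σ δ) {f : R} {s : ℕ}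
    (hf : ∀ j, s ≤ j → h.coeff j f = 0) :
    f = ∑ j ∈ Finset.range s, ι (h.coeff j f) * x ^ j := by
  refine h.ext_coeff fun n => ?_
  simp only [map_sum, coeff_monomial, Finset.sum_ite_eq', Finset.mem_range]
  split_ifs with hn
  · rfl
  · exact hf n (not_lt.1 hn)

theorem iterate_eigen {β : K} {b : B} (hb : σ b = β • b) (n : ℕ) :
    (σ^[n]) b = β ^ n • b := by
  induction n with
  | zero => simp
  | succ n ih => rw [Function.iterate_succ_apply', ih, map_smul, hb, smul_smul, pow_succ]

theorem pow_succ_apply (δ : B →ₗ[K] B) (n : ℕ) (b : B) : (δ ^ (n + 1)) b = δ ((δ ^ n) b) := by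
  rw [pow_succ', Module.End.mul_apply]

theorem pow_apply_eq_zero_of_le {δ : B →ₗ[K] B} {m n : ℕ} {b : B} (hmn : m ≤ n)
    (hm : (δ ^ m) b = 0) : (δ ^ n) b = 0 := by
  rw [← Nat.sub_add_cancel hmn, pow_add, Module.End.mul_apply, hm, map_zero]

theorem eigen_pow_apply {q β : K} (hσδ : ∀ b, σ (δ b) = q • δ (σ b)) {b : B}
    (hb : σ b = β • b) (n : ℕ) : σ ((δ ^ n) b) = (β * q ^ n) • (δ ^ n) b := by
  induction n with
  | zero => simpa using hb
  | succ n ih =>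
    rw [pow_succ_apply, hσδ, ih, map_smul, smul_smul]
    congr 1
    ring

/-- `f` has weight `θ` for the automorphism of `R` extending `σ` and sending `x` to `q • x`. -/
def HasWeight (h : IsOreExt ι x σ δ) (q θ : K) (f : R) : Prop :=
  ∀ j, q ^ j • σ (h.coeff j f) = θ • h.coeff j f

theorem HasWeight.sub {h : IsOreExt ι x σ δ} {q θ : K} {f g : R} (hf : h.HasWeight q θ f)
    (hg : h.HasWeight q θ g) : h.HasWeight q θ (f - g) := fun j => by
  simp only [map_sub, smul_sub, hf j, hg j]

theorem HasWeight.smul {h : IsOreExt ι x σ δ} {q θ : K} {f : R} (hf : h.HasWeight q θ f)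
    (c : K) : h.HasWeight q θ (c • f) := fun j => by
  simp only [map_smul]
  rw [smul_comm, hf j, smul_comm]

theorem mul_eq_of_divX {γ : K} {w f g : R} {b : B} (hw : x * w = γ • (w * x))
    (hf : f = ι b + g * x) : f * w = ι b * w + γ • (g * w) * x := by
  rw [hf, add_mul, mul_assoc g, hw, mul_smul_comm, smul_mul_assoc, mul_assoc]

theorem HasWeight.mul {h : IsOreExt ι x σ δ} {q θ' γ : K} (hq0 : q ≠ 0) {w : R}
    (hw : h.HasWeight q θ' w) (hwx : x * w = γ • (w * x)) {θ : K} {f : R}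
    (hf : h.HasWeight q θ f) : h.HasWeight q (θ * θ') (f * w) := by
  obtain ⟨s, hs⟩ := h.exists_degree_le f
  induction s generalizing f θ with
  | zero =>
    intro j
    rw [h.eq_ι_of_degree hs, coeff_ι_mul, map_mul, ← mul_smul_comm, hw j, mul_smul_comm,
      mul_smul, smul_comm, ← smul_mul_assoc]
    have := hf 0
    rw [pow_zero, one_smul] at this
    rw [this, smul_mul_assoc, smul_mul_assoc, smul_comm]
  | succ s ih =>
    obtain ⟨g, hfg, hg⟩ := h.exists_divX f
    have hmul := mul_eq_of_divX hwx hfg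
    have h0 := hf 0
    rw [pow_zero, one_smul] at h0
    have hgw : h.HasWeight q (q⁻¹ * θ) g := fun j => by
      rw [hg, mul_smul, ← hf (j + 1), smul_smul, pow_succ', inv_mul_cancel_left₀ hq0]
    have hrec := ih hgw fun j hj => by rw [hg, hs _ (by omega)]
    have hb : ∀ j, q ^ j • σ (h.coeff j (ι (h.coeff 0 f) * w)) =
        (θ * θ') • h.coeff j (ι (h.coeff 0 f) * w) := fun j => by
      rw [coeff_ι_mul, map_mul, ← mul_smul_comm, hw j, h0, smul_mul_smul_comm]
    intro j
    rw [hmul, map_add, map_add, smul_add, smul_add, hb j]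
    congr 1
    cases j with
    | zero => simp [coeff_mul_x_zero]
    | succ j =>
      have hj := hrec j
      rw [coeff_mul_x_succ, map_smul, map_smul, pow_succ', mul_smul, smul_comm _ γ, hj,
        smul_smul, smul_smul, smul_smul]
      congr 1
      field_simp

theorem eq_zero_of_hasWeight (h : IsOreExt ι x σ δ) {q γ : K} (hγ : γ ≠ 0)
    (hq0 : q ≠ 0) (hq : ∀ n, 1 ≤ n → q ^ n ≠ 1) {f : R} {n : ℕ}
    (hf : h.HasWeight q (γ * q ^ n) f) (hfx : x * f = γ • (f * x))
    (hdeg : ∀ j, n ≤ j → h.coeff j f = 0) : f = 0 := by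
  have key : ∀ t, t ≤ n → (∀ j, t ≤ j → h.coeff j f = 0) → ∀ j, h.coeff j f = 0 := by
    intro t
    induction t with
    | zero => exact fun _ h0 j => h0 j j.zero_le
    | succ t ih =>
      intro ht hj
      refine ih (by omega) fun j htj => ?_
      rcases Nat.lt_or_ge t j with hlt | hge
      · exact hj j hlt
      obtain rfl : t = j := by omega
      have h1 := congrArg (h.coeff (t + 1)) hfx
      rw [coeff_x_mul_succ, hj (t + 1) le_rfl, map_zero, add_zero, map_smul,
        coeff_mul_x_succ] at h1
      have h2 := hf t
      rw [h1, smul_smul, ← sub_eq_zero, ← sub_smul, smul_eq_zero] at h2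
      refine h2.resolve_left fun h3 => hq (n - t) (by omega) ?_
      have h4 : γ * q ^ t * (1 - q ^ (n - t)) = 0 := by
        rw [← h3]
        conv_rhs => rw [show n = t + (n - t) by omega, pow_add]
        ring
      rw [mul_eq_zero, sub_eq_zero] at h4
      exact (h4.resolve_left (mul_ne_zero hγ (pow_ne_zero _ hq0))).symm
  exact h.ext_coeff fun j => by rw [key n le_rfl hdeg j, map_zero]

/-- The coefficients of the Cauchon-type lift of a `σ`-eigenvector. -/
def liftCoeff (q β : K) (n : ℕ) : K := ∏ i ∈ Finset.range n, (β * (1 - q ^ (i + 1)))⁻¹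

theorem liftCoeff_succ {q β : K} (hβ : β ≠ 0) (hq : ∀ n, 1 ≤ n → q ^ n ≠ 1) (n : ℕ) :
    liftCoeff q β n = β * (1 - q ^ (n + 1)) * liftCoeff q β (n + 1) := by
  have : β * (1 - q ^ (n + 1)) ≠ 0 :=
    mul_ne_zero hβ (sub_ne_zero.2 (hq _ (by omega)).symm)
  rw [liftCoeff, liftCoeff, Finset.prod_range_succ, mul_comm, mul_assoc, inv_mul_cancel₀ this,
    mul_one]

theorem liftCoeff_ne_zero {q β : K} (hβ : β ≠ 0) (hq : ∀ n, 1 ≤ n → q ^ n ≠ 1) (n : ℕ) :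
    liftCoeff q β n ≠ 0 :=
  Finset.prod_ne_zero_iff.2 fun _ _ =>
    inv_ne_zero (mul_ne_zero hβ (sub_ne_zero.2 (hq _ (by omega)).symm))

/-- A `σ`-eigenvector killed by `δ ^ (k + 1)` is the leading coefficient of a polynomial of
degree `k` commuting with `x` up to a scalar. -/
theorem exists_lift (h : IsOreExt ι x σ δ) {q β : K} (hβ : β ≠ 0)
    (hq : ∀ n, 1 ≤ n → q ^ n ≠ 1) (hσδ : ∀ b, σ (δ b) = q • δ (σ b)) {b : B}
    (hb : σ b = β • b) {k : ℕ} (hk : (δ ^ (k + 1)) b = 0) :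
    ∃ V : R, (∀ j, k < j → h.coeff j V = 0) ∧
      (∀ j, j ≤ k → h.coeff j V = liftCoeff q β (k - j) • (δ ^ (k - j)) b) ∧
      x * V = β • (V * x) ∧ h.HasWeight q (β * q ^ k) V := by
  classical
  let c : ℕ →₀ B := Finsupp.onFinset (Finset.range (k + 1))
    (fun j => if j ≤ k then liftCoeff q β (k - j) • (δ ^ (k - j)) b else 0)
    (fun j hj => by
      rw [Finset.mem_range]
      by_contra hlt
      exact hj (if_neg (by omega)))
  have hc : ∀ j, h.coeff j (ofCoeff ι x c) =
      if j ≤ k then liftCoeff q β (k - j) • (δ ^ (k - j)) b else 0 := fun j =>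
    h.coeff_ofCoeff j c
  refine ⟨ofCoeff ι x c, fun j hj => by rw [hc, if_neg (by omega)],
    fun j hj => by rw [hc, if_pos hj], h.ext_coeff fun j => ?_, fun j => ?_⟩
  · rw [map_smul]
    cases j with
    | zero =>
      rw [coeff_x_mul_zero, coeff_mul_x_zero, hc, if_pos k.zero_le, map_smul, ← pow_succ_apply,
        Nat.sub_zero, hk, smul_zero, smul_zero]
    | succ j =>
      rw [coeff_x_mul_succ, coeff_mul_x_succ, hc, hc]
      rcases lt_trichotomy j k with hj | rfl | hj
      · obtain ⟨i, rfl⟩ : ∃ i, k = j + i + 1 := ⟨k - j - 1, by omega⟩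
        rw [if_pos (by omega), if_pos (by omega), show j + i + 1 - j = i + 1 by omega,
          show j + i + 1 - (j + 1) = i by omega, map_smul, map_smul, eigen_pow_apply hσδ hb,
          ← pow_succ_apply, liftCoeff_succ hβ hq i, smul_smul, smul_smul, ← add_smul]
        congr 1
        ring
      · rw [if_pos le_rfl, if_neg (by omega), Nat.sub_self, map_zero, add_zero, pow_zero,
          Module.End.one_apply, map_smul, hb, smul_comm]
      · rw [if_neg (by omega), if_neg (by omega), map_zero, map_zero, add_zero, smul_zero]
  · rw [hc]
    split_ifs with hj
    · rw [map_smul, eigen_pow_apply hσδ hb, smul_smul, smul_smul, smul_smul]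
      congr 1
      conv_rhs => rw [← Nat.sub_add_cancel hj, pow_add]
      simp only [Nat.add_sub_cancel]
      ring
    · simp

/-- If `w` commutes with `x` up to a scalar and has nonzero constant coefficient, then
`f * x ∈ Rw` implies `f ∈ Rw`. -/
theorem exists_eq_mul_of_mul_x [IsDomain B] (h : IsOreExt ι x σ δ) {γ : K} {w f g : R}
    (hw : x * w = γ • (w * x)) (hw0 : h.coeff 0 w ≠ 0) (hfg : f * x = g * w) :
    ∃ g', f = g' * w := by
  obtain ⟨g', hg, _⟩ := h.exists_divX g
  have hmul := mul_eq_of_divX hw hg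
  have h0 : h.coeff 0 g = 0 := by
    have := congrArg (h.coeff 0) (hfg.trans hmul)
    rw [map_add, coeff_mul_x_zero, coeff_mul_x_zero, coeff_ι_mul, add_zero, eq_comm,
      mul_eq_zero] at this
    exact this.resolve_right hw0
  refine ⟨γ • g', h.mul_x_cancel ?_⟩
  simp only [hfg, hmul, h0, map_zero, zero_mul, zero_add, smul_mul_assoc]

theorem exists_eq_mul_of_mul_x_pow [IsDomain B] (h : IsOreExt ι x σ δ) {γ : K} {w : R}
    (hw : x * w = γ • (w * x)) (hw0 : h.coeff 0 w ≠ 0) (n : ℕ) :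
    ∀ f g : R, f * x ^ n = g * w → ∃ g', f = g' * w := by
  induction n with
  | zero => exact fun f g hfg => ⟨g, by simpa using hfg⟩
  | succ n ih =>
    intro f g hfg
    rw [pow_succ, ← mul_assoc] at hfg
    obtain ⟨g', hg'⟩ := h.exists_eq_mul_of_mul_x hw hw0 hfg
    exact ih f g' hg'

end QComm

end IsOreExt

section NormalizingMap

variable {K B : Type*} [Field K] [Ring B] [Algebra K B] [IsDomain B] {u : B} {φ : B → B}

theorem normalizing_add (hu : u ≠ 0) (hφ : ∀ b, u * b = φ b * u) (a b : B) :
    φ (a + b) = φ a + φ b :=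
  mul_right_cancel₀ hu (by rw [← hφ, mul_add, add_mul, hφ, hφ])

theorem normalizing_smul (hu : u ≠ 0) (hφ : ∀ b, u * b = φ b * u) (c : K) (b : B) :
    φ (c • b) = c • φ b :=
  mul_right_cancel₀ hu (by rw [← hφ, mul_smul_comm, hφ, smul_mul_assoc])

theorem normalizing_comm (hu : u ≠ 0) (hφ : ∀ b, u * b = φ b * u) {σ : B ≃ₐ[K] B} {α : K}
    (hα0 : α ≠ 0) (hα : σ u = α • u) (b : B) : φ (σ b) = σ (φ b) := by
  have h1 := congrArg σ (hφ b)
  rw [map_mul, map_mul, hα, smul_mul_assoc, mul_smul_comm] at h1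
  exact mul_right_cancel₀ hu ((hφ _).symm.trans (smul_right_injective B hα0 h1))

end NormalizingMap

namespace IsOreExt

section Inner

variable {K B R : Type*} [Field K] [Ring B] [Algebra K B] [Ring R] [Algebra K R]
  {ι : B →ₐ[K] R} {x : R} {σ : B ≃ₐ[K] B} {δ : B →ₗ[K] B}

theorem coeff_x_pow_mul_ι (h : IsOreExt ι x σ δ) (b : B) (n : ℕ) :
    ∀ j, n < j → h.coeff j (x ^ n * ι b) = 0 := by
  induction n with
  | zero =>
    intro j hj
    rw [pow_zero, one_mul, coeff_ι, if_neg (by omega)]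
  | succ n ih =>
    intro j hj
    obtain ⟨j, rfl⟩ : ∃ i, j = i + 1 := ⟨j - 1, by omega⟩
    rw [pow_succ', mul_assoc, coeff_x_mul_succ, ih _ (by omega), ih _ (by omega), map_zero,
      map_zero, add_zero]

theorem coeff_x_pow_mul_ι_self (h : IsOreExt ι x σ δ) (b : B) (n : ℕ) :
    h.coeff n (x ^ n * ι b) = (σ^[n]) b := by
  induction n with
  | zero => simp [coeff_ι_zero]
  | succ n ih =>
    rw [pow_succ', mul_assoc, coeff_x_mul_succ, ih, h.coeff_x_pow_mul_ι b n _ (by omega),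
      map_zero, add_zero, Function.iterate_succ_apply']

theorem coeff_x_pow_succ_mul_ι (h : IsOreExt ι x σ δ) {q β : K}
    (hσδ : ∀ b, σ (δ b) = q • δ (σ b)) {b : B} (hb : σ b = β • b) (n : ℕ) :
    h.coeff n (x ^ (n + 1) * ι b) = (β ^ n * ∑ i ∈ Finset.range (n + 1), q ^ i) • δ b := by
  induction n with
  | zero => simp [coeff_x_mul_zero, coeff_ι_zero]
  | succ n ih =>
    rw [pow_succ', mul_assoc, coeff_x_mul_succ, ih, coeff_x_pow_mul_ι_self, iterate_eigen hb,
      map_smul, map_smul, hσδ, hb, map_smul, smul_smul, smul_smul, ← add_smul]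
    congr 1
    rw [geom_sum_succ (n := n + 1)]
    ring

theorem coeff_mul_ι (h : IsOreExt ι x σ δ) {q β : K}
    (hσδ : ∀ b, σ (δ b) = q • δ (σ b)) {b : B} (hb : σ b = β • b) {m : ℕ} {w : R}
    (hw : ∀ j, m + 1 < j → h.coeff j w = 0) :
    h.coeff m (w * ι b) = (β ^ m * ∑ i ∈ Finset.range (m + 1), q ^ i) •
      (h.coeff (m + 1) w * δ b) + β ^ m • (h.coeff m w * b) := by
  have hs := h.eq_sum_range (s := m + 2) (f := w) fun j hj => hw j (by omega)
  have key : ∀ j, h.coeff m (ι (h.coeff j w) * x ^ j * ι b) =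
      h.coeff j w * h.coeff m (x ^ j * ι b) := fun j => by rw [mul_assoc, coeff_ι_mul]
  conv_lhs => rw [hs]
  rw [Finset.sum_mul, map_sum, Finset.sum_range_succ, Finset.sum_range_succ,
    Finset.sum_eq_zero, key, key, coeff_x_pow_mul_ι_self, coeff_x_pow_succ_mul_ι h hσδ hb,
    iterate_eigen hb, mul_smul_comm, mul_smul_comm, zero_add, add_comm]
  intro j hj
  rw [key, h.coeff_x_pow_mul_ι b j m (Finset.mem_range.1 hj), mul_zero]

variable [IsDomain B] {u : B} {φ : B → B} {q α : K}

/-- The lift of a normal `σ`-eigenvector `u` normalizes `R`. -/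
theorem exists_lift_mul_ι (h : IsOreExt ι x σ δ) (hq0 : q ≠ 0)
    (hq : ∀ n, 1 ≤ n → q ^ n ≠ 1) (hσδ : ∀ b, σ (δ b) = q • δ (σ b))
    (hspan : ∀ b, b ∈ Submodule.span K {b : B | ∃ β : K, β ≠ 0 ∧ σ b = β • b})
    (hnil : ∀ b : B, ∃ n : ℕ, (δ ^ n) b = 0) (hu : u ≠ 0) (hφ : ∀ b, u * b = φ b * u)
    (hα0 : α ≠ 0) (hα : σ u = α • u) {M : ℕ} {w : R} (hdeg : ∀ j, M < j → h.coeff j w = 0)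
    (hw0 : h.coeff 0 w ≠ 0) (hwM : h.coeff M w = u) (hwx : x * w = α • (w * x))
    (hwt : h.HasWeight q (α * q ^ M) w) (b : B) : ∃ g, w * ι b = g * w := by
  have hright : ∀ f : R, (∃ g, w * f = g * w) → ∀ n, ∃ g, w * (f * x ^ n) = g * w := by
    rintro f ⟨g, hg⟩ n
    induction n with
    | zero => exact ⟨g, by rw [pow_zero, mul_one, hg]⟩
    | succ n ih =>
      obtain ⟨g', hg'⟩ := ih
      refine ⟨α⁻¹ • (g' * x), ?_⟩
      rw [pow_succ, ← mul_assoc, ← mul_assoc, mul_assoc w, hg', smul_mul_assoc, mul_assoc g' x,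
        hwx, mul_smul_comm, inv_smul_smul₀ hα0, mul_assoc]
  have heig : ∀ k : ℕ, ∀ (β : K) (b : B), β ≠ 0 → σ b = β • b → (δ ^ k) b = 0 →
      ∃ g, w * ι b = g * w := by
    intro k
    induction k with
    | zero =>
      intro β b _ _ hb
      rw [pow_zero, Module.End.one_apply] at hb
      exact ⟨0, by simp [hb]⟩
    | succ k ih =>
      intro β b hβ hb hk
      obtain ⟨l, hl⟩ := hnil (φ b)
      have hφb : σ (φ b) = β • φ b := by
        rw [← normalizing_comm hu hφ hα0 hα, hb, normalizing_smul hu hφ]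
      obtain ⟨V, hV1, hV2, hV3, hV4⟩ := h.exists_lift hβ hq hσδ hb (k := k + l)
        (pow_apply_eq_zero_of_le (by omega) hk)
      obtain ⟨W, hW1, hW2, hW3, hW4⟩ := h.exists_lift hβ hq hσδ hφb (k := k + l)
        (pow_apply_eq_zero_of_le (by omega) hl)
      have hVt : h.coeff (k + l) V = b := by
        rw [hV2 _ le_rfl, Nat.sub_self]
        simp [liftCoeff]
      have hWt : h.coeff (k + l) W = φ b := by
        rw [hW2 _ le_rfl, Nat.sub_self]
        simp [liftCoeff]
      have hwV := h.coeff_mul_top M (k + l) w V hdeg hV1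
      have hWw := h.coeff_mul_top (k + l) M W w hW1 hdeg
      have hzero : α ^ (k + l) • (w * V) - β ^ M • (W * w) = 0 := by
        refine h.eq_zero_of_hasWeight (γ := α * β) (n := M + (k + l)) (mul_ne_zero hα0 hβ) hq0 hq
          ?_ ?_ ?_
        · refine HasWeight.sub (HasWeight.smul ?_ _) (HasWeight.smul ?_ _)
          · convert HasWeight.mul hq0 hV4 hV3 hwt using 1
            ring
          · convert HasWeight.mul hq0 hwt hwx hW4 using 1
            ring
        · have e1 : x * (w * V) = (α * β) • (w * V * x) := by
            rw [← mul_assoc, hwx, smul_mul_assoc, mul_assoc w x, hV3, mul_smul_comm, smul_smul,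
              mul_assoc]
          have e2 : x * (W * w) = (α * β) • (W * w * x) := by
            rw [← mul_assoc, hW3, smul_mul_assoc, mul_assoc W x, hwx, mul_smul_comm, smul_smul,
              mul_assoc, mul_comm]
          rw [mul_sub, mul_smul_comm, mul_smul_comm, e1, e2, sub_mul, smul_sub, smul_mul_assoc,
            smul_mul_assoc, smul_comm (α ^ _), smul_comm (β ^ _)]
        · intro j hj
          rw [map_sub, map_smul, map_smul]
          rcases Nat.lt_or_ge (M + (k + l)) j with hlt | hge
          · rw [hwV.1 j hlt, hWw.1 j (by omega), smul_zero, smul_zero, sub_zero]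
          · obtain rfl : j = M + (k + l) := by omega
            rw [hwV.2, add_comm M, hWw.2, hVt, hWt, hwM, iterate_eigen hb, iterate_eigen hα,
              mul_smul_comm, mul_smul_comm, hφ, smul_comm, sub_self]
      have hV : ∃ g, w * V = g * w := by
        refine ⟨(α ^ (k + l))⁻¹ • β ^ M • W, ?_⟩
        rw [sub_eq_zero] at hzero
        rw [smul_mul_assoc, smul_mul_assoc, ← hzero, inv_smul_smul₀ (pow_ne_zero _ hα0)]
      have hlow : ∀ j ∈ Finset.range (k + l), ∃ g, w * (ι (h.coeff j V) * x ^ j) = g * w := by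
        intro j hj
        rw [Finset.mem_range] at hj
        refine hright _ ?_ j
        obtain ⟨i, hi⟩ : ∃ i, k + l - j = i + 1 := ⟨k + l - j - 1, by omega⟩
        rw [hV2 j hj.le, hi]
        refine ih (β * q ^ (i + 1)) _ (mul_ne_zero hβ (pow_ne_zero _ hq0)) ?_ ?_
        · rw [map_smul, eigen_pow_apply hσδ hb, smul_comm]
        · rw [map_smul, ← Module.End.mul_apply, ← pow_add,
            pow_apply_eq_zero_of_le (by omega) hk, smul_zero]
      choose! g hg using hlow
      obtain ⟨G, hG⟩ := hV
      have hsum := h.eq_sum_range (s := k + l + 1) (f := V) fun j hj => hV1 j (by omega)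
      rw [Finset.sum_range_succ, hVt] at hsum
      refine h.exists_eq_mul_of_mul_x_pow hwx hw0 (k + l) _
        (G - ∑ j ∈ Finset.range (k + l), g j) ?_
      rw [sub_mul, ← hG, Finset.sum_mul, ← Finset.sum_congr rfl hg, ← Finset.mul_sum, ← mul_sub,
        sub_eq_iff_eq_add'.2 hsum, mul_assoc]
  refine Submodule.span_induction (p := fun b _ => ∃ g, w * ι b = g * w) ?_ ?_ ?_ ?_ (hspan b)
  · rintro b ⟨β, hβ, hb⟩
    obtain ⟨k, hk⟩ := hnil b
    exact heig k β b hβ hb hk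
  · exact ⟨0, by simp⟩
  · rintro a b _ _ ⟨g, hg⟩ ⟨g', hg'⟩
    exact ⟨g + g', by rw [map_add, mul_add, add_mul, hg, hg']⟩
  · rintro c b _ ⟨g, hg⟩
    exact ⟨c • g, by rw [map_smul, mul_smul_comm, smul_mul_assoc, hg]⟩

/-- If `u` is a normal `σ`-eigenvector with `δ u ≠ 0`, then `δ` becomes inner after inverting
`u`, and is implemented by a multiple of `u⁻¹ * δ u`. -/
theorem exists_inner (h : IsOreExt ι x σ δ) (hq0 : q ≠ 0)
    (hq : ∀ n, 1 ≤ n → q ^ n ≠ 1) (hσδ : ∀ b, σ (δ b) = q • δ (σ b))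
    (hspan : ∀ b, b ∈ Submodule.span K {b : B | ∃ β : K, β ≠ 0 ∧ σ b = β • b})
    (hnil : ∀ b : B, ∃ n : ℕ, (δ ^ n) b = 0) (hu : u ≠ 0) (hφ : ∀ b, u * b = φ b * u)
    (hα0 : α ≠ 0) (hα : σ u = α • u) (hδu : δ u ≠ 0) :
    ∃ ρ : K, ρ ≠ 0 ∧ ∀ b, u * δ b = (ρ • δ u) * b - φ (σ b) * (ρ • δ u) := by
  classical
  have hex := hnil u
  obtain ⟨m, hm⟩ : ∃ m, Nat.find hex = m + 2 := by
    have h2 : 2 ≤ Nat.find hex := by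
      rw [Nat.le_find_iff]
      intro j hj
      interval_cases j
      · simpa using hu
      · simpa using hδu
    exact ⟨Nat.find hex - 2, by omega⟩
  have hlast : (δ ^ (m + 1)) u ≠ 0 := Nat.find_min hex (by omega)
  have hkill : (δ ^ (m + 1 + 1)) u = 0 := hm ▸ Nat.find_spec hex
  obtain ⟨w, hdeg, hcoeff, hwx, hwt⟩ := h.exists_lift hα0 hq hσδ hα hkill
  have hw0 : h.coeff 0 w ≠ 0 := by
    rw [hcoeff 0 (by omega), Nat.sub_zero]
    exact smul_ne_zero (liftCoeff_ne_zero hα0 hq _) hlast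
  have hwM : h.coeff (m + 1) w = u := by
    rw [hcoeff _ le_rfl, Nat.sub_self]
    simp [liftCoeff]
  have hwm : h.coeff m w = liftCoeff q α 1 • δ u := by
    rw [hcoeff m (by omega), Nat.add_sub_cancel_left, pow_one]
  set s : K := ∑ i ∈ Finset.range (m + 1), q ^ i with hs
  have hs0 : s ≠ 0 := by
    intro h0
    have h1 := geom_sum_mul q (m + 1)
    rw [← hs, h0, zero_mul, eq_comm, sub_eq_zero] at h1
    exact hq _ (by omega) h1
  have heig : ∀ b ∈ {b : B | ∃ β : K, β ≠ 0 ∧ σ b = β • b},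
      s • (u * δ b) = φ (σ b) * h.coeff m w - h.coeff m w * b := by
    rintro b ⟨β, hβ, hb⟩
    obtain ⟨g, hg⟩ := h.exists_lift_mul_ι hq0 hq hσδ hspan hnil hu hφ hα0 hα hdeg hw0 hwM hwx hwt b
    have htop := h.coeff_mul_top (m + 1) 0 w (ι b) hdeg fun j hj => by
      rw [coeff_ι, if_neg (by omega)]
    rw [add_zero] at htop
    have hgι := h.eq_ι_of_mul (by rwa [hwM]) hdeg (hg ▸ htop.1)
    have htop' := htop.2
    rw [hg, hgι, coeff_ι_mul, hwM, coeff_ι_zero, iterate_eigen hb, mul_smul_comm, hφ,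
      ← smul_mul_assoc] at htop'
    have hnext := h.coeff_mul_ι hσδ hb hdeg
    rw [hg, hgι, coeff_ι_mul, mul_right_cancel₀ hu htop', hwM, ← hs] at hnext
    rw [hb, normalizing_smul hu hφ, eq_sub_iff_add_eq]
    refine smul_right_injective B (pow_ne_zero m hβ) ?_
    simp only [smul_add]
    rw [smul_smul, ← hnext, ← smul_mul_assoc, smul_smul, ← pow_succ]
  have hall : ∀ b, s • (u * δ b) = φ (σ b) * h.coeff m w - h.coeff m w * b := fun b => by
    refine Submodule.span_induction
      (p := fun b _ => s • (u * δ b) = φ (σ b) * h.coeff m w - h.coeff m w * b)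
      heig ?_ ?_ ?_ (hspan b)
    · have : φ 0 = 0 := by simpa using normalizing_smul (K := K) hu hφ 0 0
      simp [this]
    · intro a b _ _ ha hb
      rw [map_add, map_add, normalizing_add hu hφ, mul_add, smul_add, ha, hb, add_mul, mul_add]
      abel
    · intro c b _ hb
      rw [map_smul, map_smul, normalizing_smul hu hφ, mul_smul_comm, smul_comm, hb,
        smul_mul_assoc, mul_smul_comm, smul_sub]
  refine ⟨-(s⁻¹ * liftCoeff q α 1),
    neg_ne_zero.2 (mul_ne_zero (inv_ne_zero hs0) (liftCoeff_ne_zero hα0 hq 1)), fun b => ?_⟩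
  have hb := hall b
  rw [hwm] at hb
  refine smul_right_injective B hs0 ?_
  simp only [smul_sub, smul_mul_assoc, mul_smul_comm, smul_smul] at hb ⊢
  rw [hb, mul_neg, mul_inv_cancel_left₀ hs0, neg_smul, neg_smul]
  abel

end Inner

end IsOreExt

section NormalPrime

variable {B : Type*} [Ring B] {u : B}

theorem IsNormalElem.exists_mul_eq (hu : IsNormalElem u) (b : B) : ∃ c, u * b = c * u := by
  have h : u * b ∈ {y : B | ∃ t : B, y = u * t} := ⟨b, rfl⟩
  rwa [IsNormalElem.eq_1 u |>.mp hu] at h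

theorem IsNormalElem.exists_eq_mul (hu : IsNormalElem u) (b : B) : ∃ c, b * u = u * c := by
  have h : b * u ∈ {y : B | ∃ t : B, y = t * u} := ⟨b, rfl⟩
  rwa [← IsNormalElem.eq_1 u |>.mp hu] at h

theorem IsNormalElem.exists_pow_mul_eq (hu : IsNormalElem u) (n : ℕ) (b : B) :
    ∃ c, u ^ n * b = c * u ^ n := by
  induction n with
  | zero => exact ⟨b, by simp⟩
  | succ n ih =>
    obtain ⟨c, hc⟩ := ih
    obtain ⟨e, he⟩ := hu.exists_mul_eq c
    exact ⟨e, by rw [pow_succ', mul_assoc, hc, ← mul_assoc, he, mul_assoc]⟩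

end NormalPrime

section NormalizingDerivation

variable {K B : Type*} [Field K] [Ring B] [Algebra K B] [IsDomain B] {u d : B} {φ : B → B}
  {σ : B ≃ₐ[K] B} {δ : B →ₗ[K] B} {q α : K}

theorem normalizing_self (hu : u ≠ 0) (hφ : ∀ b, u * b = φ b * u) : φ u = u :=
  mul_right_cancel₀ hu (hφ u).symm

/-- A locally nilpotent `σ`-derivation inner with respect to a `q`-eigenvector vanishes. -/
theorem eq_zero_of_inner (hq : ∀ n, 1 ≤ n → q ^ n ≠ 1) (hnil : ∀ b : B, ∃ n : ℕ, (δ ^ n) b = 0)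
    {a : B} (ha : σ a = q • a) (hδ : ∀ b, δ b = a * b - σ b * a) : a = 0 := by
  by_contra ha0
  have key : ∀ k, ∃ c : K, c ≠ 0 ∧ (δ ^ k) a = c • a ^ (k + 1) := by
    intro k
    induction k with
    | zero => exact ⟨1, one_ne_zero, by simp⟩
    | succ k ih =>
      obtain ⟨c, hc, hk⟩ := ih
      refine ⟨c * (1 - q ^ (k + 1)),
        mul_ne_zero hc (sub_ne_zero.2 (hq _ (by omega)).symm), ?_⟩
      rw [IsOreExt.pow_succ_apply, hk, map_smul, hδ, map_pow, ha, smul_pow, smul_mul_assoc,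
        ← pow_succ, ← pow_succ', mul_smul, sub_smul, one_smul]
  obtain ⟨n, hn⟩ := hnil a
  obtain ⟨c, hc, hk⟩ := key n
  rw [hk] at hn
  exact smul_ne_zero hc (pow_ne_zero _ ha0) hn

theorem mul_self_of_inner (hu : u ≠ 0) (hφ : ∀ b, u * b = φ b * u) (hα : σ u = α • u)
    (hd : ∀ b, u * δ b = d * b - φ (σ b) * d) : d * u = u * δ u + α • (u * d) := by
  have := hd u
  rw [hα, normalizing_smul hu hφ, normalizing_self hu hφ, smul_mul_assoc] at this
  rw [this, sub_add_cancel]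

/-- If `δ` is implemented by `u⁻¹ * ρ • δ u` after inverting `u` and `δ u ∈ Bu`,
then `δ u = 0`. -/
theorem apply_eq_zero_of_dvd (hq : ∀ n, 1 ≤ n → q ^ n ≠ 1)
    (hσδ : ∀ b, σ (δ b) = q • δ (σ b)) (hnil : ∀ b : B, ∃ n : ℕ, (δ ^ n) b = 0) (hu : u ≠ 0)
    (hφ : ∀ b, u * b = φ b * u) (hα0 : α ≠ 0) (hα : σ u = α • u) {ρ : K} (hρ : ρ ≠ 0)
    (hd : ∀ b, u * δ b = (ρ • δ u) * b - φ (σ b) * (ρ • δ u)) (hdvd : NDvd u (δ u)) :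
    δ u = 0 := by
  obtain ⟨c, hc⟩ := hdvd
  by_contra hne
  have h1 := mul_self_of_inner hu hφ hα hd
  have h2 : c * u = (ρ⁻¹ + α) • (u * c) := by
    refine mul_right_cancel₀ hu (smul_right_injective B hρ ?_)
    simp only [hc, smul_mul_assoc, mul_smul_comm] at h1 ⊢
    rw [h1, smul_smul, smul_smul, mul_add, mul_inv_cancel₀ hρ, add_smul, one_smul, mul_comm α,
      mul_assoc]
  have hσc : σ c = q • c := by
    refine mul_right_cancel₀ hu (smul_right_injective B hα0 ?_)
    have h3 := hσδ u
    rw [hα, map_smul, hc, map_mul, hα, mul_smul_comm] at h3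
    simp only
    rw [h3, smul_mul_assoc, smul_comm]
  have h4 := eq_zero_of_inner hq hnil (a := (ρ * (ρ⁻¹ + α)) • c)
    (by rw [map_smul, hσc, smul_comm]) fun b => by
      refine mul_left_cancel₀ hu ?_
      rw [hd, hc, h2, mul_sub, smul_mul_assoc, ← mul_assoc, mul_smul_comm, ← mul_assoc, hφ (σ b)]
      simp only [smul_mul_assoc, mul_smul_comm, smul_smul, mul_assoc]
  refine hne (smul_right_injective B hρ ?_)
  simp only
  rw [hc, h2, smul_smul, ← mul_smul_comm, h4, mul_zero, smul_zero]

theorem exists_inner_of_not_dvd (hσδ : ∀ b, σ (δ b) = q • δ (σ b)) (hu : IsPrimeElem u) (hφ : ∀ b, u * b = φ b * u)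
    (hα : σ u = α • u) {ρ : K} (hρ : ρ ≠ 0)
    (hd : ∀ b, u * δ b = (ρ • δ u) * b - φ (σ b) * (ρ • δ u)) (hdvd : ¬ NDvd u (δ u)) :
    ∃ d, ¬ NDvd u d ∧ σ d = (α * q) • d ∧ (∀ b, u * δ b = d * b - φ (σ b) * d) ∧ u * d = (α * q)⁻¹ • (d * u) ∧
      δ u = (α * (q - 1)) • d ∧ δ d = 0 := by
  have hu0 := hu.1
  obtain ⟨d, hd_def⟩ : ∃ d, d = ρ • δ u := ⟨_, rfl⟩
  simp only [← hd_def] at hd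
  have hδu : δ u = ρ⁻¹ • d := by rw [hd_def, inv_smul_smul₀ hρ]
  have hdd : ¬ NDvd u d := by
    rintro ⟨t, ht⟩
    exact hdvd ⟨ρ⁻¹ • t, by rw [hδu, ht, smul_mul_assoc]⟩
  have hd0 : d ≠ 0 := fun h0 => hdd ⟨0, by rw [h0, zero_mul]⟩
  have hσd : σ d = (α * q) • d := by
    rw [hd_def, map_smul, hσδ, hα, map_smul, smul_smul q, smul_comm, mul_comm]
  have h1 := mul_self_of_inner hu0 hφ hα hd
  rw [hδu, mul_smul_comm, ← add_smul] at h1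
  have hκ : ρ⁻¹ + α ≠ 0 := by
    intro h0
    rw [h0, zero_smul] at h1
    exact mul_ne_zero hd0 hu0 h1
  have hud : u * d = (ρ⁻¹ + α)⁻¹ • (d * u) := by rw [h1, inv_smul_smul₀ hκ]
  have hφd : φ d = (ρ⁻¹ + α)⁻¹ • d :=
    mul_right_cancel₀ hu0 (by rw [← hφ, hud, smul_mul_assoc])
  have h2 := hd d
  rw [hσd, normalizing_smul hu0 hφ, hφd, smul_smul, smul_mul_assoc] at h2
  replace h2 : u * δ d = (1 - α * q * (ρ⁻¹ + α)⁻¹) • (d * d) := by rw [h2, sub_smul, one_smul]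
  have h3 : 1 - α * q * (ρ⁻¹ + α)⁻¹ = 0 := by
    by_contra hne
    have : NDvd u (d * d) := by
      obtain ⟨t, ht⟩ := hu.2.1.exists_mul_eq (δ d)
      refine ⟨(1 - α * q * (ρ⁻¹ + α)⁻¹)⁻¹ • t, ?_⟩
      rw [smul_mul_assoc, ← ht, h2, inv_smul_smul₀ hne]
    exact (hu.2.2.2 d d this).elim hdd hdd
  have h4 : ρ⁻¹ + α = α * q := by
    rw [← one_mul (ρ⁻¹ + α), (eq_mul_inv_iff_mul_eq₀ hκ).1 (sub_eq_zero.1 h3)]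
  refine ⟨d, hdd, hσd, hd, h4 ▸ hud, ?_, ?_⟩
  · rw [hδu]
    congr 1
    linear_combination h4
  · rw [h3, zero_smul] at h2
    exact (mul_eq_zero.1 h2).resolve_left hu0

theorem eq_of_inner (hq : ∀ n, 1 ≤ n → q ^ n ≠ 1) (hu : u ≠ 0) (hφ : ∀ b, u * b = φ b * u)
    (hα : σ u = α • u) {d' : B} (hσd : σ d = (α * q) • d)
    (hσd' : σ d' = (α * q) • d') (hd : ∀ b, u * δ b = d * b - φ (σ b) * d)
    (hd' : ∀ b, u * δ b = d' * b - φ (σ b) * d') : d' = d := by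
  have hh : ∀ b, (d' - d) * b = φ (σ b) * (d' - d) := fun b => by
    have := (hd b).symm.trans (hd' b)
    rw [sub_mul, mul_sub, ← sub_eq_sub_iff_sub_eq_sub, this]
  obtain ⟨e, he⟩ : ∃ e, e = d' - d := ⟨_, rfl⟩
  simp only [← he] at hh
  have hσe : σ e = (α * q) • e := by rw [he, map_sub, hσd, hσd', smul_sub]
  have h1 := hh u
  rw [hα, normalizing_smul hu hφ, normalizing_self hu hφ, smul_mul_assoc] at h1
  have hφe : α • φ e = e := mul_right_cancel₀ hu (by rw [h1, smul_mul_assoc, hφ])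
  have h2 := hh e
  rw [hσe, normalizing_smul hu hφ, mul_comm, mul_smul, hφe, smul_mul_assoc] at h2
  replace h2 : (1 - q) • (e * e) = 0 := by rw [sub_smul, one_smul, ← h2, sub_self]
  rw [smul_eq_zero, sub_eq_zero, mul_self_eq_zero] at h2
  exact sub_eq_zero.1 (he ▸ h2.resolve_left fun h3 => hq 1 le_rfl (by rw [pow_one, h3]))

end NormalizingDerivation

namespace IsOreExt

section Prime

variable {K B R : Type*} [Field K] [Ring B] [Algebra K B] [Ring R] [Algebra K R]
  {ι : B →ₐ[K] R} {x : R} {σ : B ≃ₐ[K] B} {δ : B →ₗ[K] B} {u d : B} {φ : B → B} {q α : K}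

theorem coeff_linear_zero (h : IsOreExt ι x σ δ) (a b : B) :
    h.coeff 0 (ι a * x - ι b) = -b := by
  rw [map_sub, coeff_mul_x_zero, coeff_ι_zero, zero_sub]

theorem coeff_linear_one (h : IsOreExt ι x σ δ) (a b : B) :
    h.coeff 1 (ι a * x - ι b) = a := by
  rw [map_sub, coeff_mul_x_succ, coeff_ι_succ, coeff_ι_zero, sub_zero]

theorem coeff_linear_of_lt (h : IsOreExt ι x σ δ) (a b : B) (j : ℕ) (hj : 1 < j) :
    h.coeff j (ι a * x - ι b) = 0 := by
  obtain ⟨j, rfl⟩ : ∃ i, j = i + 2 := ⟨j - 2, by omega⟩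
  rw [map_sub, coeff_mul_x_succ, coeff_ι_succ, coeff_ι_succ, sub_zero]

theorem linear_mul_ι (h : IsOreExt ι x σ δ) (a d b : B) :
    (ι a * x - ι d) * ι b = ι (a * σ b) * x - ι (d * b - a * δ b) := by
  rw [sub_mul, mul_assoc, h.comm, mul_add, ← mul_assoc, ← map_mul, ← map_mul, ← map_mul, map_sub]
  abel

theorem pow_mul_of_comm {w : R} (hw : x * w = α • (w * x)) (n : ℕ) :
    x ^ n * w = α ^ n • (w * x ^ n) := by
  induction n with
  | zero => simp
  | succ n ih =>
    rw [pow_succ', mul_assoc, ih, mul_smul_comm, ← mul_assoc, hw, smul_mul_assoc, smul_smul,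
      mul_assoc, pow_succ]

theorem isNormalElem_of_comm (h : IsOreExt ι x σ δ) {w : R} {ψ : B → B} (hα0 : α ≠ 0)
    (hw : x * w = α • (w * x)) (hψ : ∀ b, w * ι b = ι (ψ b) * w)
    (hsurj : Function.Surjective ψ) : IsNormalElem w := by
  have h1 : ∀ f, ∃ g, w * f = g * w := fun f => by
    induction f using h.induct with
    | h0 => exact ⟨0, by simp⟩
    | hadd f g hf hg =>
      obtain ⟨f', hf⟩ := hf
      obtain ⟨g', hg⟩ := hg
      exact ⟨f' + g', by rw [mul_add, add_mul, hf, hg]⟩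
    | hmono b n =>
      refine ⟨(α ^ n)⁻¹ • (ι (ψ b) * x ^ n), ?_⟩
      rw [smul_mul_assoc, mul_assoc _ (x ^ n), pow_mul_of_comm hw, mul_smul_comm,
        inv_smul_smul₀ (pow_ne_zero _ hα0), ← mul_assoc, ← mul_assoc, hψ]
  have h2 : ∀ f, ∃ g, f * w = w * g := fun f => by
    induction f using h.induct with
    | h0 => exact ⟨0, by simp⟩
    | hadd f g hf hg =>
      obtain ⟨f', hf⟩ := hf
      obtain ⟨g', hg⟩ := hg
      exact ⟨f' + g', by rw [mul_add, add_mul, hf, hg]⟩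
    | hmono b n =>
      obtain ⟨b, rfl⟩ := hsurj b
      refine ⟨α ^ n • (ι b * x ^ n), ?_⟩
      rw [mul_assoc, pow_mul_of_comm hw, mul_smul_comm, mul_smul_comm, ← mul_assoc, ← mul_assoc, hψ]
  ext y
  constructor
  · rintro ⟨t, rfl⟩
    exact h1 t
  · rintro ⟨t, rfl⟩
    exact h2 t

theorem nDvd_apply_of_isNormalElem (h : IsOreExt ι x σ δ) (hu : IsNormalElem u)
    (hn : IsNormalElem (ι u)) : NDvd u (δ u) := by
  obtain ⟨t, ht⟩ := hn.exists_eq_mul x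
  obtain ⟨c, hc⟩ := hu.exists_mul_eq (h.coeff 0 t)
  refine ⟨c, ?_⟩
  rw [← hc, ← coeff_ι_mul, ← ht, coeff_x_mul_zero, coeff_ι_zero]

theorem nDvd_ι_iff (h : IsOreExt ι x σ δ) (hu : IsNormalElem u) (hn : IsNormalElem (ι u))
    (f : R) : NDvd (ι u) f ↔ ∀ n, NDvd u (h.coeff n f) := by
  constructor
  · rintro ⟨t, rfl⟩ n
    obtain ⟨s, hs⟩ := hn.exists_eq_mul t
    rw [hs, coeff_ι_mul]
    exact hu.exists_mul_eq _
  · intro hf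
    have : ∀ n, ∃ c, h.coeff n f = u * c := fun n => by
      obtain ⟨c, hc⟩ := hf n
      rw [hc]
      exact hu.exists_eq_mul c
    choose c hc using this
    obtain ⟨s, hs⟩ := h.exists_degree_le f
    have hsum := h.eq_sum_range (s := s + 1) (f := f) fun j hj => hs j (by omega)
    simp only [hc, map_mul, mul_assoc, ← Finset.mul_sum] at hsum
    rw [hsum]
    exact hn.exists_mul_eq _

theorem exists_truncation (h : IsOreExt ι x σ δ) (hu : IsNormalElem u)
    (hn : IsNormalElem (ι u)) {f : R} (hf : ¬ NDvd (ι u) f) :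
    ∃ s g, NDvd (ι u) (f - g) ∧ ¬ NDvd u (h.coeff s g) ∧ ∀ j, s < j → h.coeff j g = 0 := by
  classical
  rw [h.nDvd_ι_iff hu hn] at hf
  push Not at hf
  obtain ⟨n, hn'⟩ := hf
  have hzero : NDvd u 0 := ⟨0, by simp⟩
  obtain ⟨N, hN⟩ := h.exists_degree_le f
  have hnN : n ≤ N := by
    by_contra hlt
    exact hn' (by rwa [hN n (by omega)])
  set s := Nat.findGreatest (fun j => ¬ NDvd u (h.coeff j f)) N with hs
  have hcoeff : ∀ j, h.coeff j (∑ i ∈ Finset.range (s + 1), ι (h.coeff i f) * x ^ i) =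
      if j ≤ s then h.coeff j f else 0 := fun j => by
    simp [map_sum, coeff_monomial, Finset.sum_ite_eq']
  refine ⟨s, ∑ j ∈ Finset.range (s + 1), ι (h.coeff j f) * x ^ j, ?_, ?_, fun j hj => ?_⟩
  · rw [h.nDvd_ι_iff hu hn]
    intro j
    rw [map_sub, hcoeff]
    split_ifs with hj
    · rwa [sub_self]
    · rw [sub_zero]
      rcases Nat.lt_or_ge N j with hjN | hjN
      · rwa [hN j hjN]
      · exact not_not.1 (Nat.findGreatest_is_greatest (not_le.1 hj) hjN)
  · rw [hcoeff, if_pos le_rfl]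
    exact Nat.findGreatest_spec (P := fun j => ¬ NDvd u (h.coeff j f)) hnN hn'
  · rw [hcoeff, if_neg (by omega)]

/-- A prime `σ`-eigenvector killed by `δ` stays prime in the Ore extension. -/
theorem isPrimeElem_ι (h : IsOreExt ι x σ δ) (hu : IsPrimeElem u) (hφ : ∀ b, u * b = φ b * u)
    (hφs : Function.Surjective φ) (hα0 : α ≠ 0) (hα : σ u = α • u) (hδu : δ u = 0) :
    IsPrimeElem (ι u) := by
  have hn : IsNormalElem (ι u) := by
    refine h.isNormalElem_of_comm hα0 ?_ (fun b => by rw [← map_mul, hφ, map_mul]) hφs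
    rw [h.comm, hδu, hα, map_zero, add_zero, map_smul, smul_mul_assoc]
  refine ⟨fun h0 => hu.1 (h.ι_injective (by rw [h0, map_zero])), hn, fun h1 => ?_,
    fun f g hfg => ?_⟩
  · have := (h.nDvd_ι_iff hu.2.1 hn 1).1 h1 0
    rw [← map_one ι, coeff_ι_zero] at this
    exact hu.2.2.1 this
  · by_contra! hne
    obtain ⟨s, f', hf1, hf2, hf3⟩ := h.exists_truncation hu.2.1 hn hne.1
    obtain ⟨t, g', hg1, hg2, hg3⟩ := h.exists_truncation hu.2.1 hn hne.2
    have hfg' : NDvd (ι u) (f' * g') := by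
      obtain ⟨p, hp⟩ := hfg
      obtain ⟨a, ha⟩ := hf1
      obtain ⟨b, hb⟩ := hg1
      obtain ⟨g'', hg''⟩ := hn.exists_mul_eq g'
      refine ⟨p - f * b - a * g'', ?_⟩
      rw [sub_mul, sub_mul, ← hp, mul_assoc f, ← hb, mul_assoc a, ← hg'', ← mul_assoc, ← ha]
      noncomm_ring
    have htop := (h.nDvd_ι_iff hu.2.1 hn _).1 hfg' (s + t)
    rw [(h.coeff_mul_top s t f' g' hf3 hg3).2] at htop
    refine (hu.2.2.2 _ _ htop).elim hf2 fun h4 => hg2 ?_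
    obtain ⟨c, hc⟩ := h4
    obtain ⟨e, rfl⟩ := σ.surjective.iterate s c
    refine ⟨(α ^ s)⁻¹ • e, σ.injective.iterate s ?_⟩
    have hmul : ∀ a b, (σ^[s]) (a * b) = (σ^[s]) a * (σ^[s]) b := fun a b =>
      iterate_map_mul σ s a b
    have he : (σ^[s]) ((α ^ s)⁻¹ • e) = (α ^ s)⁻¹ • (σ^[s]) e := by
      rw [← AlgEquiv.coe_pow, map_smul]
    rw [hmul, he, hc, iterate_eigen hα, mul_smul_comm, smul_mul_assoc,
      smul_inv_smul₀ (pow_ne_zero _ hα0)]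

/-- Modulo `ι u * x - ι d`, every polynomial becomes constant after multiplication by a power
of `u`. -/
theorem exists_pow_mul_eq (h : IsOreExt ι x σ δ) (hφ : ∀ b, u * b = φ b * u) (hα0 : α ≠ 0)
    (hvx : x * (ι u * x - ι d) = α • ((ι u * x - ι d) * x)) (f : R) :
    ∃ (k : ℕ) (r : R) (b : B), ι u ^ k * f = r * (ι u * x - ι d) + ι b := by
  set v := ι u * x - ι d with hv
  induction f using h.induct with
  | h0 => exact ⟨0, 0, 0, by simp⟩
  | hadd f g hf hg =>
    obtain ⟨k, r, b, hf⟩ := hf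
    obtain ⟨l, s, c, hg⟩ := hg
    refine ⟨l + k, ι u ^ l * r + ι u ^ k * s, u ^ l * b + u ^ k * c, ?_⟩
    rw [mul_add, pow_add, mul_assoc, hf, (Commute.refl (ι u)).pow_pow l k |>.eq, mul_assoc, hg]
    simp only [map_add, map_mul, map_pow, mul_add, add_mul, mul_assoc]
    abel
  | hmono b n =>
    induction n generalizing b with
    | zero => exact ⟨0, 0, b, by simp⟩
    | succ n ih =>
      obtain ⟨k, r, c, hk⟩ := ih (φ b * d)
      refine ⟨k + 1, ι u ^ k * ((α ^ n)⁻¹ • (ι (φ b) * x ^ n)) + r, c, ?_⟩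
      have hstep : ι u * (ι b * x ^ (n + 1)) =
          (α ^ n)⁻¹ • (ι (φ b) * x ^ n) * v + ι (φ b * d) * x ^ n := by
        rw [smul_mul_assoc, mul_assoc (ι (φ b)), pow_mul_of_comm hvx, mul_smul_comm,
          inv_smul_smul₀ (pow_ne_zero _ hα0), map_mul, mul_assoc, ← mul_add, ← add_mul, hv,
          sub_add_cancel, ← mul_assoc, ← map_mul, hφ, map_mul, pow_succ', mul_assoc, mul_assoc]
      rw [pow_succ, mul_assoc, hstep, mul_add, hk, add_mul, ← mul_assoc, add_assoc]

variable [IsDomain B]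

theorem exists_eq_mul_of_ι_mul (h : IsOreExt ι x σ δ) (hu : IsPrimeElem u) (hα0 : α ≠ 0)
    (hd : ¬ NDvd u d) (hvx : x * (ι u * x - ι d) = α • ((ι u * x - ι d) * x)) (n : ℕ) :
    ∀ f s : R, (∀ j, n ≤ j → h.coeff j s = 0) → ι u * f = s * (ι u * x - ι d) →
      ∃ g, f = g * (ι u * x - ι d) := by
  set v := ι u * x - ι d with hv
  induction n with
  | zero =>
    intro f s hs hf
    have hs0 : s = 0 := h.ext_coeff fun j => by rw [hs j j.zero_le, map_zero]
    refine ⟨0, h.ext_coeff fun j => mul_left_cancel₀ hu.1 ?_⟩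
    rw [← coeff_ι_mul, hf, hs0, zero_mul, map_zero, mul_zero]
  | succ n ih =>
    intro f s hs hf
    obtain ⟨g, hg, hgc⟩ := h.exists_divX s
    have hmul := mul_eq_of_divX hvx hg
    obtain ⟨c, hc⟩ : ∃ c, h.coeff 0 s = u * c := by
      have h0 := congrArg (h.coeff 0) (hf.trans hmul)
      rw [coeff_ι_mul, map_add, coeff_mul_x_zero, coeff_ι_mul, hv, coeff_linear_zero, add_zero,
        mul_neg] at h0
      obtain ⟨e, he⟩ := hu.2.1.exists_mul_eq (h.coeff 0 f)
      have : NDvd u (h.coeff 0 s * d) := ⟨-e, by rw [neg_mul, ← he, h0, neg_neg]⟩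
      obtain ⟨c, hc⟩ := (hu.2.2.2 _ _ this).resolve_right hd
      rw [hc]
      exact hu.2.1.exists_eq_mul c
    have hf' : ι u * (f - ι c * v) = α • (g * v) * x := by
      rw [mul_sub, hf, hmul, hc, map_mul, mul_assoc, add_sub_cancel_left]
    obtain ⟨f', hff', hf'c⟩ := h.exists_divX (f - ι c * v)
    have h0 : h.coeff 0 (f - ι c * v) = 0 := by
      refine mul_left_cancel₀ hu.1 ?_
      rw [← coeff_ι_mul, hf', coeff_mul_x_zero, mul_zero]
    rw [h0, map_zero, zero_add] at hff'
    rw [hff', ← mul_assoc] at hf'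
    obtain ⟨p, hp⟩ := ih f' (α • g) (fun j hj => by rw [map_smul, hgc, hs _ (by omega), smul_zero])
      (by rw [h.mul_x_cancel hf', smul_mul_assoc])
    refine ⟨ι c + α⁻¹ • (p * x), ?_⟩
    rw [add_mul, smul_mul_assoc, mul_assoc p, hvx, mul_smul_comm, inv_smul_smul₀ hα0, ← mul_assoc,
      ← hp, ← hff', add_sub_cancel]

theorem isPrimeElem_linear (h : IsOreExt ι x σ δ) (hu : IsPrimeElem u)
    (hφ : ∀ b, u * b = φ b * u) (hφs : Function.Surjective φ) (hα0 : α ≠ 0) (hd : ¬ NDvd u d)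
    (hvx : x * (ι u * x - ι d) = α • ((ι u * x - ι d) * x))
    (hvb : ∀ b, (ι u * x - ι d) * ι b = ι (φ (σ b)) * (ι u * x - ι d)) :
    IsPrimeElem (ι u * x - ι d) := by
  have hn := h.isNormalElem_of_comm hα0 hvx hvb (hφs.comp σ.surjective)
  have htop : h.coeff 1 (ι u * x - ι d) ≠ 0 := by rw [coeff_linear_one]; exact hu.1
  have hdeg := h.coeff_linear_of_lt u d
  have hconst : ∀ e, NDvd (ι u * x - ι d) (ι e) → e = 0 := by
    rintro e ⟨t, ht⟩
    have ht0 : t = 0 := h.eq_zero_of_mul htop hdeg fun j hj => by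
      rw [← ht, coeff_ι, if_neg (by omega)]
    exact h.ι_injective (by rw [ht, ht0, zero_mul, map_zero])
  have hcancel : ∀ (k : ℕ) (f : R), NDvd (ι u * x - ι d) (ι u ^ k * f) →
      NDvd (ι u * x - ι d) f := by
    intro k
    induction k with
    | zero => exact fun f hf => by simpa using hf
    | succ k ih =>
      rintro f ⟨s, hs⟩
      rw [pow_succ', mul_assoc] at hs
      obtain ⟨n, hn⟩ := h.exists_degree_le s
      exact ih f (h.exists_eq_mul_of_ι_mul hu hα0 hd hvx (n + 1) _ s
        (fun j hj => hn j (by omega)) hs)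
  refine ⟨fun h0 => htop (by rw [h0, map_zero]), hn, fun h1 => one_ne_zero (hconst 1 (by
    rwa [map_one])), fun f g hfg => ?_⟩
  obtain ⟨k, r, b, hf⟩ := h.exists_pow_mul_eq hφ hα0 hvx f
  obtain ⟨l, s, c, hg⟩ := h.exists_pow_mul_eq hφ hα0 hvx g
  obtain ⟨p, hp⟩ := hfg
  obtain ⟨b', hb'⟩ := hu.2.1.exists_pow_mul_eq l b
  obtain ⟨g', hg'⟩ := hn.exists_mul_eq g
  have hbc : b' * c = 0 := by
    refine hconst _ ⟨ι u ^ l * (ι u ^ k * p - r * g') - ι b' * s, ?_⟩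
    have h1 : ι b * g = (ι u ^ k * p - r * g') * (ι u * x - ι d) := by
      rw [sub_mul, mul_assoc, ← hp, mul_assoc r, ← hg', ← mul_assoc, ← mul_assoc, ← sub_mul, hf,
        add_sub_cancel_left]
    have h2 : ι b' * (ι u ^ l * g) = ι u ^ l * (ι b * g) := by
      rw [← mul_assoc, ← mul_assoc, ← map_pow, ← map_mul, ← map_mul, hb']
    rw [hg, h1, mul_add, ← map_mul] at h2
    rw [sub_mul, mul_assoc, ← h2, mul_assoc, add_sub_cancel_left]
  rcases mul_eq_zero.1 hbc with h0 | h0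
  · left
    rw [h0, zero_mul] at hb'
    have hb := (mul_eq_zero.1 hb').resolve_left (pow_ne_zero l hu.1)
    exact hcancel k f ⟨r, by rw [hf, hb, map_zero, add_zero]⟩
  · right
    exact hcancel l g ⟨s, by rw [hg, h0, map_zero, add_zero]⟩

theorem inner_of_isNormalElem (h : IsOreExt ι x σ δ) (hu : u ≠ 0) (hφ : ∀ b, u * b = φ b * u)
    (hv : IsNormalElem (ι u * x - ι d)) (b : B) : u * δ b = d * b - φ (σ b) * d := by
  obtain ⟨g, hg⟩ := hv.exists_mul_eq (ι b)
  have hgι := h.eq_ι_of_mul (t := 1) (by rwa [coeff_linear_one]) (h.coeff_linear_of_lt u d)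
    fun j hj => by rw [← hg, h.linear_mul_ι, h.coeff_linear_of_lt _ _ j hj]
  rw [hgι, h.linear_mul_ι] at hg
  have h1 := congrArg (h.coeff 1) hg
  have h0 := congrArg (h.coeff 0) hg
  rw [coeff_linear_one, coeff_ι_mul, coeff_linear_one, hφ] at h1
  rw [coeff_linear_zero, coeff_ι_mul, coeff_linear_zero, ← mul_right_cancel₀ hu h1, mul_neg,
    neg_inj] at h0
  rw [← h0, sub_sub_cancel]

/-- If `δ u = 0`, no homogeneous linear polynomial with leading coefficient `u` is prime. -/
theorem not_isPrimeElem_linear (h : IsOreExt ι x σ δ) (hq : ∀ n, 1 ≤ n → q ^ n ≠ 1)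
    (hu : IsPrimeElem u) (hφ : ∀ b, u * b = φ b * u) (hα : σ u = α • u)
    (hδu : δ u = 0) (hσd : σ d = (α * q) • d) : ¬ IsPrimeElem (ι u * x - ι d) := by
  intro hv
  have hu0 := hu.1
  have hd := h.inner_of_isNormalElem hu0 hφ hv.2.1
  have h1 := mul_self_of_inner hu0 hφ hα hd
  rw [hδu, mul_zero, zero_add] at h1
  have hφd : α • φ d = d := mul_right_cancel₀ hu0 (by rw [h1, smul_mul_assoc, hφ])
  have h2 := hd d
  rw [hσd, normalizing_smul hu0 hφ, mul_comm α, mul_smul, hφd, smul_mul_assoc] at h2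
  replace h2 : u * δ d = (1 - q) • (d * d) := by rw [h2, sub_smul, one_smul]
  obtain ⟨c, hc⟩ : NDvd u d := by
    have h3 : NDvd u (d * d) := by
      obtain ⟨t, ht⟩ := hu.2.1.exists_mul_eq (δ d)
      refine ⟨(1 - q)⁻¹ • t, ?_⟩
      rw [smul_mul_assoc, ← ht, h2, inv_smul_smul₀]
      exact sub_ne_zero.2 fun h4 => hq 1 le_rfl (by rw [pow_one, h4])
    exact (hu.2.2.2 d d h3).elim id id
  obtain ⟨e, he⟩ := hu.2.1.exists_eq_mul c
  have hfac : ι u * (x - ι e) = ι u * x - ι d := by rw [mul_sub, ← map_mul, ← he, ← hc]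
  have htop : h.coeff 1 (ι u * x - ι d) ≠ 0 := by rwa [coeff_linear_one]
  have hdeg := h.coeff_linear_of_lt u d
  rcases hv.2.2.2 (ι u) (x - ι e) ⟨1, by rw [hfac, one_mul]⟩ with ⟨t, ht⟩ | ⟨t, ht⟩
  · have ht0 : t = 0 := h.eq_zero_of_mul htop hdeg fun j hj => by
      rw [← ht, coeff_ι, if_neg (by omega)]
    rw [ht0, zero_mul] at ht
    exact hu0 (h.ι_injective (by rw [ht, map_zero]))
  · have hx : x - ι e = ι 1 * x - ι e := by rw [map_one, one_mul]
    rw [hx] at ht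
    have htι := h.eq_ι_of_mul htop hdeg (ht ▸ h.coeff_linear_of_lt 1 e)
    have h3 := congrArg (h.coeff 1) ht
    rw [htι, coeff_ι_mul, coeff_linear_one, coeff_linear_one] at h3
    exact hu.2.2.1 ⟨_, h3⟩

/-- If `δ u ≠ 0`, some linear polynomial with leading coefficient `u` is prime. -/
theorem exists_isPrimeElem_linear (h : IsOreExt ι x σ δ) (hq0 : q ≠ 0)
    (hq : ∀ n, 1 ≤ n → q ^ n ≠ 1) (hσδ : ∀ b, σ (δ b) = q • δ (σ b))
    (hspan : ∀ b, b ∈ Submodule.span K {b : B | ∃ β : K, β ≠ 0 ∧ σ b = β • b})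
    (hnil : ∀ b : B, ∃ n : ℕ, (δ ^ n) b = 0) (hu : IsPrimeElem u) (hφ : ∀ b, u * b = φ b * u)
    (hφs : Function.Surjective φ) (hα0 : α ≠ 0) (hα : σ u = α • u) (hδu : δ u ≠ 0) :
    ¬ NDvd u (δ u) ∧ ∃ d, σ d = (α * q) • d ∧ (∀ b, u * δ b = d * b - φ (σ b) * d) ∧
      u * d = (α * q)⁻¹ • (d * u) ∧ δ u = (α * (q - 1)) • d ∧ δ d = 0 ∧
      x * (ι u * x - ι d) = α • ((ι u * x - ι d) * x) ∧
      (∀ b, (ι u * x - ι d) * ι b = ι (φ (σ b)) * (ι u * x - ι d)) ∧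
      IsPrimeElem (ι u * x - ι d) := by
  obtain ⟨ρ, hρ, hinner⟩ := h.exists_inner hq0 hq hσδ hspan hnil hu.1 hφ hα0 hα hδu
  have hdvd : ¬ NDvd u (δ u) := fun hdvd =>
    hδu (apply_eq_zero_of_dvd hq hσδ hnil hu.1 hφ hα0 hα hρ hinner hdvd)
  obtain ⟨d, hdd, hσd, hd, hud, hδud, hδd⟩ :=
    exists_inner_of_not_dvd hσδ hu hφ hα hρ hinner hdvd
  have hvx : x * (ι u * x - ι d) = α • ((ι u * x - ι d) * x) := by
    rw [mul_sub, ← mul_assoc, h.comm, h.comm, hσd, hα, hδd, hδud, map_zero, add_zero, map_smul,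
      map_smul, map_smul, add_mul, smul_mul_assoc, smul_mul_assoc, smul_mul_assoc,
      smul_mul_assoc, sub_mul, smul_sub, add_sub_assoc, ← sub_smul, mul_sub, mul_one,
      sub_sub_cancel_left, neg_smul, ← sub_eq_add_neg]
  have hvb : ∀ b, (ι u * x - ι d) * ι b = ι (φ (σ b)) * (ι u * x - ι d) := fun b => by
    rw [h.linear_mul_ι, hd, sub_sub_cancel, hφ, map_mul, map_mul, mul_sub, mul_assoc]
  exact ⟨hdvd, d, hσd, hd, hud, hδud, hδd, hvx, hvb,
    h.isPrimeElem_linear hu hφ hφs hα0 hdd hvx hvb⟩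

end Prime

end IsOreExt

section GradedOre

variable {K B R : Type*} [Field K] [Ring B] [Algebra K B] [Ring R] [Algebra K R]
  {ι : B →ₐ[K] R} {x : R} {σ : B ≃ₐ[K] B} {δ : B →ₗ[K] B} {r : ℕ}
  {ℬ : (Fin r → ℤ) → Submodule K B}
  {𝒜 : (Fin r → ℤ) → Submodule K R} [GradedAlgebra 𝒜] {h0 : Fin r → Kˣ} {l : Fin r → ℤ}

theorem tpow_add (t : Fin r → Kˣ) (m n : Fin r → ℤ) : tpow t (m + n) = tpow t m * tpow t n := by
  simp [tpow, zpow_add, Finset.prod_mul_distrib]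

theorem IsOreExt.apply_mem_graded (h : IsOreExt ι x σ δ)
    (hgr : ∀ m : Fin r → ℤ, ∀ b : B, b ∈ ℬ m ↔ ι b ∈ 𝒜 m) (hx : x ∈ 𝒜 l)
    (hσ : ∀ m : Fin r → ℤ, ∀ b ∈ ℬ m, σ b = ((tpow h0 m : Kˣ) : K) • b) {m : Fin r → ℤ} {b : B}
    (hb : b ∈ ℬ m) : δ b ∈ ℬ (m + l) := by
  have hιb := (hgr m b).1 hb
  rw [hgr, ← add_sub_cancel_left (ι (σ b) * x) (ι (δ b)), ← h.comm, hσ m b hb, map_smul,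
    smul_mul_assoc]
  refine sub_mem ?_ (Submodule.smul_mem _ _ (SetLike.mul_mem_graded hιb hx))
  rw [add_comm]
  exact SetLike.mul_mem_graded hx hιb

variable [GradedAlgebra ℬ]

theorem mem_span_eigenvectors
    (hσ : ∀ m : Fin r → ℤ, ∀ b ∈ ℬ m, σ b = ((tpow h0 m : Kˣ) : K) • b) (b : B) :
    b ∈ Submodule.span K {b : B | ∃ β : K, β ≠ 0 ∧ σ b = β • b} := by
  induction b using DirectSum.Decomposition.inductionOn ℬ with
  | zero => exact zero_mem _
  | @homogeneous m b => exact Submodule.subset_span ⟨_, (tpow h0 m).ne_zero, hσ m b b.2⟩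
  | add a b ha hb => exact add_mem ha hb

namespace IsOreExt

theorem apply_comm_of_graded (h : IsOreExt ι x σ δ)
    (hgr : ∀ m : Fin r → ℤ, ∀ b : B, b ∈ ℬ m ↔ ι b ∈ 𝒜 m) (hx : x ∈ 𝒜 l)
    (hσ : ∀ m : Fin r → ℤ, ∀ b ∈ ℬ m, σ b = ((tpow h0 m : Kˣ) : K) • b) (b : B) :
    σ (δ b) = ((tpow h0 l : Kˣ) : K) • δ (σ b) := by
  induction b using DirectSum.Decomposition.inductionOn ℬ with
  | zero => simp
  | @homogeneous m b =>
    rw [hσ _ _ (h.apply_mem_graded hgr hx hσ b.2), hσ m b b.2, map_smul, smul_smul, tpow_add,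
      Units.val_mul, mul_comm]
  | add a b ha hb => simp only [map_add, smul_add, ha, hb]

theorem decompose_ι_mem_range (hgr : ∀ m : Fin r → ℤ, ∀ b : B, b ∈ ℬ m ↔ ι b ∈ 𝒜 m) (b : B)
    (n : Fin r → ℤ) : ∃ e, (DirectSum.decompose 𝒜 (ι b) n : R) = ι e := by
  induction b using DirectSum.Decomposition.inductionOn ℬ with
  | zero => exact ⟨0, by simp⟩
  | @homogeneous m b =>
    have hb := (hgr m b).1 b.2
    by_cases hmn : m = n
    · subst hmn
      exact ⟨b, DirectSum.decompose_of_mem_same 𝒜 hb⟩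
    · exact ⟨0, by rw [DirectSum.decompose_of_mem_ne 𝒜 hb hmn, map_zero]⟩
  | add a b ha hb =>
    obtain ⟨e, he⟩ := ha
    obtain ⟨f, hf⟩ := hb
    exact ⟨e + f, by rw [map_add ι, map_add ι, DirectSum.decompose_add, DirectSum.add_apply,
      Submodule.coe_add, he, hf]⟩

theorem linear_mem_graded_iff (h : IsOreExt ι x σ δ)
    (hgr : ∀ m : Fin r → ℤ, ∀ b : B, b ∈ ℬ m ↔ ι b ∈ 𝒜 m) (hx : x ∈ 𝒜 l) {u d : B}
    (hu0 : u ≠ 0) {ν : Fin r → ℤ} (hu : u ∈ ℬ ν) :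
    (∃ m, ι u * x - ι d ∈ 𝒜 m) ↔ d ∈ ℬ (ν + l) := by
  have hux : ι u * x ∈ 𝒜 (ν + l) := SetLike.mul_mem_graded ((hgr ν u).1 hu) hx
  constructor
  · rintro ⟨m, hm⟩
    by_cases hmn : m = ν + l
    · subst hmn
      rw [hgr, ← sub_sub_cancel (ι u * x) (ι d)]
      exact sub_mem hux hm
    · exfalso
      obtain ⟨e, he⟩ := decompose_ι_mem_range hgr d (ν + l)
      have h1 := DirectSum.decompose_of_mem_ne 𝒜 hm hmn
      rw [DirectSum.decompose_sub, DirectSum.sub_apply, Submodule.coe_sub,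
        DirectSum.decompose_of_mem_same 𝒜 hux, he] at h1
      exact hu0 (by rw [← h.coeff_linear_one u e, h1, map_zero])
  · exact fun hd => ⟨ν + l, sub_mem hux ((hgr _ _).1 hd)⟩

end IsOreExt

end GradedOre

/-- **Theorem 3.6** of Goodearl–Yakimov.  Setting: `B` is a `ℤʳ`-graded
noetherian `K`-algebra domain which is an `H`-UFD for the torus action encoded
by the grading `ℬ`, and `R = B[x;σ,δ]` is a skew polynomial extension
(encoded by the embedding `ι : B →ₐ[K] R` and the element `x`, with `R` free
as a left `B`-module on the powers of `x` and `x·b = σ(b)·x + δ(b)`)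
satisfying conditions (Cx1)–(Cx5).  For a homogeneous prime element `u` of `B`
with `σ(u) = α·u`, exactly one of two situations occurs:
(i) `u` remains prime in `R`, `u·x = α⁻¹·x·u` and `δ(u) = 0`; or
(ii) there is a unique `d∘ ∈ B` such that `v := u·x − d∘` is a homogeneous
prime element of `R`, and then the further identities listed below hold.
The identities of the paper which take place in the Ore localization
`B[u⁻¹]` are stated here in denominator-cleared form:
`δ(b) = (u⁻¹d∘)·b − σ(b)·(u⁻¹d∘)` becomes `u·δ(b) = d∘·b − φ_u(σ(b))·d∘`
(where `φ_u` is the automorphism with `u·b = φ_u(b)·u`), and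
`δ(u⁻¹d∘) = −(λ∘−1)·(u⁻¹d∘)²` becomes
`δ(d∘)·u − αλ∘·δ(u)·d∘ = −α²λ∘(λ∘−1)·d∘²`. -/
theorem stmt10 {K : Type*} [Field K]
    {B : Type*} [Ring B] [Algebra K B] [IsDomain B]
    [IsNoetherianRing B] [IsNoetherianRing Bᵐᵒᵖ]
    {R : Type*} [Ring R] [Algebra K R]
    {r : ℕ} (ℬ : (Fin r → ℤ) → Submodule K B) [GradedAlgebra ℬ]
    (𝒜 : (Fin r → ℤ) → Submodule K R) [GradedAlgebra 𝒜]
    (ι : B →ₐ[K] R) (x : R)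
    (σ : B ≃ₐ[K] B) (δ : B →ₗ[K] B)
    -- `R = B[x;σ,δ]`: free left `B`-module with basis `{xⁿ}` and skew
    -- commutation rule
    (hfree : ∀ a : R, ∃! c : ℕ →₀ B, a = c.sum fun n b => ι b * x ^ n)
    (hx : ∀ b : B, x * ι b = ι (σ b) * x + ι (δ b))
    (hder : ∀ a b : B, δ (a * b) = σ a * δ b + δ a * b)
    -- (Cx2): `δ` is locally nilpotent
    (hnil : ∀ b : B, ∃ n : ℕ, (δ ^ n) b = 0)
    -- (Cx3): `B` is a graded subalgebra of `R` and `x` is homogeneous of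
    -- degree `lamx`
    (hgrsub : ∀ m : Fin r → ℤ, ∀ b : B, b ∈ ℬ m ↔ ι b ∈ 𝒜 m)
    (lamx : Fin r → ℤ) (hxhom : x ∈ 𝒜 lamx)
    -- (Cx4): `σ` is given by the torus element `h0` and
    -- `λ∘ := h0^lamx` is not a root of unity
    (h0 : Fin r → Kˣ)
    (hσ : ∀ m : Fin r → ℤ, ∀ b ∈ ℬ m, σ b = ((tpow h0 m : Kˣ) : K) • b)
    (hroot : ∀ n : ℕ, 1 ≤ n → (tpow h0 lamx) ^ n ≠ 1)
    -- (Cx5): all `H`-prime ideals of `B` are completely prime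
    (hcx5 : ∀ S : Set B, IsHPrimeIdealSet ℬ S →
      ∀ a b : B, a * b ∈ S → a ∈ S ∨ b ∈ S)
    -- `B` is an `H`-UFD
    (hufd : IsHUFDg ℬ)
    (u : B) (hu : IsPrimeElem u) (ν : Fin r → ℤ) (huhom : u ∈ ℬ ν)
    (α : Kˣ) (hα : σ u = (α : K) • u) :
    Xor'
      (IsPrimeElem (ι u))
      (∃ d : B, IsPrimeElem (ι u * x - ι d) ∧
        ∃ m : Fin r → ℤ, ι u * x - ι d ∈ 𝒜 m) ∧
    (IsPrimeElem (ι u) →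
      ι u * x = (((α⁻¹ : Kˣ) : Kˣ) : K) • (x * ι u) ∧ δ u = 0) ∧
    ((∃ d : B, IsPrimeElem (ι u * x - ι d) ∧
        ∃ m : Fin r → ℤ, ι u * x - ι d ∈ 𝒜 m) →
      ∃ d : B,
        (IsPrimeElem (ι u * x - ι d) ∧
          ∃ m : Fin r → ℤ, ι u * x - ι d ∈ 𝒜 m) ∧
        (∀ d' : B, (IsPrimeElem (ι u * x - ι d') ∧
          ∃ m : Fin r → ℤ, ι u * x - ι d' ∈ 𝒜 m) → d' = d) ∧
        d ≠ 0 ∧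
        (∃ φ : B → B, (∀ b : B, u * b = φ b * u) ∧
          (∀ b : B, u * δ b = d * b - φ (σ b) * d) ∧
          (∀ b : B, (ι u * x - ι d) * ι b = ι (φ (σ b)) * (ι u * x - ι d))) ∧
        (ι u * x - ι d) * x = ((α⁻¹ : Kˣ) : K) • (x * (ι u * x - ι d)) ∧
        u * d = ((((α * tpow h0 lamx)⁻¹ : Kˣ)) : K) • (d * u) ∧
        δ u = ((α : K) * (((tpow h0 lamx : Kˣ) : K) - 1)) • d ∧
        δ u ≠ 0 ∧
        δ d = 0 ∧
        δ d * u - ((α : K) * ((tpow h0 lamx : Kˣ) : K)) • (δ u * d) =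
          -(((α : K))^2 * ((tpow h0 lamx : Kˣ) : K) *
            (((tpow h0 lamx : Kˣ) : K) - 1)) • (d * d)) := by
  have h : IsOreExt ι x σ δ := ⟨hfree, hx, hder⟩
  have hσδ := h.apply_comm_of_graded hgrsub hxhom hσ
  have hα0 : (α : K) ≠ 0 := α.ne_zero
  have hν : tpow h0 ν = α := Units.ext (smul_left_injective K hu.1 ((hσ ν u huhom).symm.trans hα))
  have hσd : ∀ d, (∃ m, ι u * x - ι d ∈ 𝒜 m) →
      σ d = ((α : K) * ((tpow h0 lamx : Kˣ) : K)) • d := fun d hd => by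
    rw [hσ _ _ ((h.linear_mem_graded_iff hgrsub hxhom hu.1 huhom).1 hd), tpow_add, hν,
      Units.val_mul]
  have hδhom := h.apply_mem_graded hgrsub hxhom hσ huhom
  generalize tpow h0 lamx = q₀ at *
  obtain ⟨q, hq⟩ : ∃ q : K, q = (q₀ : K) := ⟨_, rfl⟩
  have hq0 : q ≠ 0 := hq ▸ q₀.ne_zero
  have hq1 : ∀ n, 1 ≤ n → q ^ n ≠ 1 := fun n hn hn' =>
    hroot n hn (Units.ext (by simpa [hq] using hn'))
  simp only [mul_inv, Units.val_mul, Units.val_inv_eq_inv_val, ← hq] at hσδ hσd ⊢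
  have hspan := mem_span_eigenvectors hσ
  choose φ hφ using hu.2.1.exists_mul_eq
  have hφs : Function.Surjective φ := fun b => by
    obtain ⟨c, hc⟩ := hu.2.1.exists_eq_mul b
    exact ⟨c, mul_right_cancel₀ hu.1 (by rw [← hφ, hc])⟩
  have hzero : δ u = 0 → ¬ ∃ d, IsPrimeElem (ι u * x - ι d) ∧ ∃ m, ι u * x - ι d ∈ 𝒜 m := by
    rintro hδu ⟨d, hd, hm⟩
    exact h.not_isPrimeElem_linear hq1 hu hφ hα hδu (hσd d hm) hd
  have hprime : IsPrimeElem (ι u) → δ u = 0 := fun hp => by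
    by_contra hδu
    exact (h.exists_isPrimeElem_linear hq0 hq1 hσδ hspan hnil hu hφ hφs hα0 hα hδu).1
      (h.nDvd_apply_of_isNormalElem hu.2.1 hp.2.1)
  have hex : δ u ≠ 0 → ∃ d, σ d = ((α : K) * q) • d ∧ (∀ b, u * δ b = d * b - φ (σ b) * d) ∧
      u * d = ((α : K) * q)⁻¹ • (d * u) ∧ δ u = ((α : K) * (q - 1)) • d ∧ δ d = 0 ∧
      x * (ι u * x - ι d) = (α : K) • ((ι u * x - ι d) * x) ∧
      (∀ b, (ι u * x - ι d) * ι b = ι (φ (σ b)) * (ι u * x - ι d)) ∧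
      IsPrimeElem (ι u * x - ι d) ∧ ∃ m, ι u * x - ι d ∈ 𝒜 m := fun hδu => by
    obtain ⟨-, d, h1, h2, h3, h4, h5, h6, h7, h8⟩ :=
      h.exists_isPrimeElem_linear hq0 hq1 hσδ hspan hnil hu hφ hφs hα0 hα hδu
    refine ⟨d, h1, h2, h3, h4, h5, h6, h7, h8,
      (h.linear_mem_graded_iff hgrsub hxhom hu.1 huhom).2 ?_⟩
    have hc : (α : K) * (q - 1) ≠ 0 :=
      mul_ne_zero hα0 (sub_ne_zero.2 fun hq' => hq1 1 le_rfl (by rw [pow_one, hq']))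
    rw [← inv_smul_smul₀ hc d, ← h4]
    exact Submodule.smul_mem _ _ hδhom
  refine ⟨?_, fun hp => ⟨?_, hprime hp⟩, fun hd => ?_⟩
  · by_cases hδu : δ u = 0
    · exact Or.inl ⟨h.isPrimeElem_ι hu hφ hφs hα0 hα hδu, hzero hδu⟩
    · obtain ⟨d, -, -, -, -, -, -, -, h8⟩ := hex hδu
      exact Or.inr ⟨⟨d, h8⟩, fun hp => hδu (hprime hp)⟩
  · rw [h.comm, hprime hp, hα, map_zero, add_zero, map_smul, smul_mul_assoc, inv_smul_smul₀ hα0]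
  · have hδu : δ u ≠ 0 := fun hδu => hzero hδu hd
    obtain ⟨d, h1, h2, h3, h4, h5, h6, h7, h8⟩ := hex hδu
    refine ⟨d, h8, fun d' hd' => ?_, fun hd0 => hδu (by rw [h4, hd0, smul_zero]),
      ⟨φ, hφ, h2, h7⟩, ?_, ?_, h4, hδu, h5, ?_⟩
    · exact eq_of_inner hq1 hu.1 hφ hα h1 (hσd d' hd'.2) h2
        (h.inner_of_isNormalElem hu.1 hφ hd'.1.2.1)
    · rw [h6, inv_smul_smul₀ hα0]
    · rw [h3, mul_inv]
    · rw [h5, h4, zero_mul, zero_sub, smul_mul_assoc, smul_smul, neg_smul, neg_inj]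
      congr 1
      ring
end

section
/- Let T be a K-algebra domain over a field K, σ a K-algebra automorphism of T, and δ a K-linear σ-derivation of T such that σ∘δ = q·δ∘σ for some q ∈ Kˣ which is not a root of unity. Suppose y ∈ T is a unit such that δᵐ(y) = 0 and δᵐ(y⁻¹) = 0 for some integer m > 0. Then δ(y) = 0 and δ(y⁻¹) = 0. -/
/-- The `p`-factorial `[1]ₚ [2]ₚ ⋯ [n]ₚ`, where `[k]ₚ = 1 + p + ⋯ + p ^ (k - 1)`. -/
def qFactorial {K : Type*} [Field K] (p : K) (n : ℕ) : K :=
  ∏ i ∈ Finset.range n, ∑ j ∈ Finset.range (i + 1), p ^ j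

theorem qFactorial_succ {K : Type*} [Field K] (p : K) (n : ℕ) :
    qFactorial p (n + 1) = qFactorial p n * ∑ j ∈ Finset.range (n + 1), p ^ j :=
  Finset.prod_range_succ _ _

theorem qFactorial_ne_zero {K : Type*} [Field K] {p : K}
    (hp : ∀ n : ℕ, 1 ≤ n → p ^ n ≠ 1) (n : ℕ) : qFactorial p n ≠ 0 := by
  refine Finset.prod_ne_zero_iff.2 fun i _ h => hp (i + 1) (by omega) ?_
  have := geom_sum_mul p (i + 1)
  rw [h, zero_mul] at this
  exact sub_eq_zero.1 this.symm

theorem iterate_skewDerivation_apply_aut {K T : Type*} [Field K] [Ring T] [Algebra K T]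
    (σ : T ≃ₐ[K] T) (δ : T →ₗ[K] T) (p : K) (hcomm : ∀ a : T, δ (σ a) = p • σ (δ a))
    (n : ℕ) (a : T) : δ^[n] (σ a) = p ^ n • σ (δ^[n] a) := by
  induction n with
  | zero => simp
  | succ n ih =>
    rw [Function.iterate_succ_apply', ih, map_smul, hcomm, smul_smul, ← pow_succ,
      Function.iterate_succ_apply']

/-- The top-degree term of the `q`-Leibniz rule for a skew derivation. -/
theorem iterate_skewDerivation_mul {K T : Type*} [Field K] [Ring T] [Algebra K T]
    (σ : T ≃ₐ[K] T) (δ : T →ₗ[K] T)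
    (hder : ∀ a b : T, δ (a * b) = σ a * δ b + δ a * b)
    (p : K) (hcomm : ∀ a : T, δ (σ a) = p • σ (δ a)) (n : ℕ) :
    ∀ (r s : ℕ) (a b : T), r + s = n → δ^[r + 1] a = 0 → δ^[s + 1] b = 0 →
      (qFactorial p r * qFactorial p s) • δ^[n] (a * b) =
        qFactorial p n • (σ^[s] (δ^[r] a) * δ^[s] b) := by
  induction n with
  | zero =>
    intro r s a b h _ _
    obtain ⟨rfl, rfl⟩ : r = 0 ∧ s = 0 := by omega
    simp [qFactorial]
  | succ n ih =>
    intro r s a b h ha hb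
    set X := σ^[s] (δ^[r] a) * δ^[s] b with hX
    have hright : (qFactorial p r * qFactorial p s) • δ^[n] (σ a * δ b) =
        (qFactorial p n * (p ^ r * ∑ j ∈ Finset.range s, p ^ j)) • X := by
      cases s with
      | zero =>
        have hb' : δ b = 0 := hb
        simp [hb']
      | succ s =>
        have hs := ih r s (σ a) (δ b) (by omega)
          (by rw [iterate_skewDerivation_apply_aut σ δ p hcomm, ha, map_zero, smul_zero]) hb
        have hσ : σ^[s] (p ^ r • σ (δ^[r] a)) = p ^ r • σ^[s + 1] (δ^[r] a) := by
          rw [Function.iterate_succ_apply]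
          exact Function.Semiconj.iterate_right
            (f := fun x : T => p ^ r • x) (fun x => (map_smul σ (p ^ r) x).symm) s _ |>.symm
        rw [iterate_skewDerivation_apply_aut σ δ p hcomm, hσ, smul_mul_assoc,
          ← Function.iterate_succ_apply, ← hX] at hs
        rw [qFactorial_succ, ← mul_assoc, mul_comm _ (∑ j ∈ _, _), mul_smul, hs, smul_smul,
          smul_smul]
        congr 1
        ring
    have hleft : (qFactorial p r * qFactorial p s) • δ^[n] (δ a * b) =
        (qFactorial p n * ∑ j ∈ Finset.range r, p ^ j) • X := by
      cases r with
      | zero =>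
        have ha' : δ a = 0 := ha
        simp [ha']
      | succ r =>
        have hr := ih r s (δ a) b (by omega) ha hb
        rw [← Function.iterate_succ_apply, ← hX] at hr
        rw [qFactorial_succ, mul_right_comm, mul_comm _ (∑ j ∈ _, _), mul_smul, hr, smul_smul,
          mul_comm]
    have hadd : δ^[n] (σ a * δ b + δ a * b) = δ^[n] (σ a * δ b) + δ^[n] (δ a * b) := by
      simp only [← Module.End.pow_apply, map_add]
    rw [Function.iterate_succ_apply, hder, hadd, smul_add, hright, hleft, ← add_smul,
      qFactorial_succ, ← h, Finset.sum_range_add]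
    simp only [pow_add, ← Finset.mul_sum]
    congr 1
    ring

theorem exists_iterate_ne_zero_and_iterate_succ_eq_zero {T : Type*} [Zero T] (f : T → T) {x : T}
    (hx : x ≠ 0) {m : ℕ} (hm : f^[m] x = 0) : ∃ r, f^[r] x ≠ 0 ∧ f^[r + 1] x = 0 := by
  by_contra! h
  have hne : ∀ n, f^[n] x ≠ 0 := fun n => Nat.rec hx (fun k hk => h k hk) n
  exact hne m hm


/-- **Lemma 4.5** of Goodearl–Yakimov: let `T` be a `K`-algebra domain, `σ` an
automorphism and `δ` a `σ`-derivation with `σ∘δ = q·δ∘σ` for `q ∈ Kˣ` not a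
root of unity.  If `y` is a unit with `δᵐ(y) = δᵐ(y⁻¹) = 0` for some `m > 0`,
then `δ(y) = δ(y⁻¹) = 0`. -/
theorem stmt13 {K : Type*} [Field K] {T : Type*} [Ring T] [Algebra K T]
    [IsDomain T]
    (σ : T ≃ₐ[K] T) (δ : T →ₗ[K] T)
    (hder : ∀ a b : T, δ (a * b) = σ a * δ b + δ a * b)
    (q : Kˣ) (hq : ∀ n : ℕ, 1 ≤ n → q ^ n ≠ 1)
    (hcomm : ∀ a : T, σ (δ a) = (q : K) • δ (σ a))
    (y : Tˣ) (m : ℕ) (hm : 0 < m)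
    (h1 : (δ ^ m) ((y : Tˣ) : T) = 0) (h2 : (δ ^ m) (((y⁻¹ : Tˣ)) : T) = 0) :
    δ ((y : Tˣ) : T) = 0 ∧ δ (((y⁻¹ : Tˣ)) : T) = 0 := by
  have hp : ∀ n : ℕ, 1 ≤ n → ((q : K)⁻¹) ^ n ≠ 1 := fun n hn h => hq n hn <| by
    ext
    simpa using h
  have hcomm' : ∀ a : T, δ (σ a) = (q : K)⁻¹ • σ (δ a) := fun a => by
    rw [hcomm, smul_smul, inv_mul_cancel₀ q.ne_zero, one_smul]
  rw [Module.End.pow_apply] at h1 h2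
  obtain ⟨r, hr, hr'⟩ := exists_iterate_ne_zero_and_iterate_succ_eq_zero δ y.ne_zero h1
  obtain ⟨s, hs, hs'⟩ := exists_iterate_ne_zero_and_iterate_succ_eq_zero δ y⁻¹.ne_zero h2
  have hone : δ 1 = 0 := by simpa using hder 1 1
  have hrs : r + s = 0 := by
    by_contra hne
    obtain ⟨n, hn⟩ := Nat.exists_eq_succ_of_ne_zero hne
    have key := iterate_skewDerivation_mul σ δ hder _ hcomm' _ r s _ _ rfl hr' hs'
    rw [Units.mul_inv, hn, Function.iterate_succ_apply, hone, ← Module.End.pow_apply, map_zero,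
      smul_zero] at key
    have hσ : σ^[s] (δ^[r] (y : T)) ≠ 0 := fun h =>
      hr (σ.injective.iterate s (h.trans (Function.iterate_fixed (map_zero σ) s).symm))
    exact smul_ne_zero (qFactorial_ne_zero hp _) (mul_ne_zero hσ hs) key.symm
  obtain ⟨rfl, rfl⟩ : r = 0 ∧ s = 0 := by omega
  exact ⟨hr', hs'⟩
end
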